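/- arXiv:math/0511149 — 6 statements merged into one kernel-verified Lean document; each statement's English description precedes it below -/
import Mathlib

section
/- Let a, b ∈ ℂ. Suppose y₀ is a solution of P_VI(a, b−1, b, a+1; t₁) on an open set U ⊆ ℂ, and y₁ = K_{[−a, b−1, −b, 1−a; t₁]} y₀ is defined on U. Let V ⊆ ℂ be open with τ² ∈ U, τ ∉ {0,1,−1} for τ ∈ V, and let η : V → ℂ be differentiable with η(τ)² = y₁(τ²). Assume 2a(η(τ)+τ)(y₀(τ²)−η(τ)) + (b−a)(τ+1)(y₀(τ²)−η(τ)²) ≠ 0 on V. Suppose Y is twice differentiable on a neighbourhood of {(τ+1)²/(τ−1)² : τ ∈ V}, satisfies Y((τ+1)²/(τ−1)²) = (τ+1)·(2a(η+τ)(y₀+η) + (b−a)(τ−1)(y₀−η²)) / ((τ−1)·(2a(η+τ)(y₀−η) + (b−a)(τ+1)(y₀−η²))) for all τ ∈ V (with η = η(τ), y₀ = y₀(τ²)), and avoids 0, 1 and its argument where the argument lies outside {0,1}. Then Y satisfies P_VI(1/2, a, b, 1/2; T₁) at every T₁ = (τ+1)²/(τ−1)², τ ∈ V. -/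
/-- The right-hand side of the sixth Painlevé equation with local monodromy
differences `θ0, θ1, θt, θinf` (via `α = (θ∞−1)²/2`, `β = −θ₀²/2`,
`γ = θ₁²/2`, `δ = (1−θ_t²)/2`), evaluated on the function `y` at the point `t`. -/
noncomputable def pviRHS (θ0 θ1 θt θinf : ℂ) (y : ℂ → ℂ) (t : ℂ) : ℂ :=
  (1/2) * (1/(y t) + 1/(y t - 1) + 1/(y t - t)) * (deriv y t)^2
    - (1/t + 1/(t-1) + 1/(y t - t)) * deriv y t
    + (y t * (y t - 1) * (y t - t) / (t^2 * (t-1)^2)) *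
      ((θinf - 1)^2/2 + (-(θ0^2/2)) * t/(y t)^2 + (θ1^2/2) * (t-1)/(y t - 1)^2
        + ((1 - θt^2)/2) * (t*(t-1))/(y t - t)^2)

/-- `y` satisfies the sixth Painlevé equation `P_VI(θ0,θ1,θt,θinf)` at the point `t`. -/
def PVIAt (θ0 θ1 θt θinf : ℂ) (y : ℂ → ℂ) (t : ℂ) : Prop :=
  deriv (deriv y) t = pviRHS θ0 θ1 θt θinf y t

/-- `y` is a solution of the sixth Painlevé equation `P_VI(θ0,θ1,θt,θinf;t)` on the
open set `U ⊆ ℂ`: `U` is open, `t ∉ {0,1}` and `y t ∉ {0,1,t}` on `U`, `y` is twice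
differentiable on `U`, and the Painlevé VI equation holds at every point of `U`. -/
def IsPVISolutionOn (θ0 θ1 θt θinf : ℂ) (y : ℂ → ℂ) (U : Set ℂ) : Prop :=
  IsOpen U ∧
  (∀ t ∈ U, t ≠ 0 ∧ t ≠ 1 ∧ y t ≠ 0 ∧ y t ≠ 1 ∧ y t ≠ t) ∧
  (∀ t ∈ U, DifferentiableAt ℂ y t ∧ DifferentiableAt ℂ (deriv y) t) ∧
  (∀ t ∈ U, PVIAt θ0 θ1 θt θinf y t)

/-- The denominator `Z(t)` appearing in the Okamoto transformation. -/
noncomputable def okZ (ν0 ν1 νt : ℂ) (y : ℂ → ℂ) (t : ℂ) : ℂ :=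
  ((t-1) * deriv y t - ν0) / (y t)
    - (t * deriv y t + ν1) / (y t - 1)
    + (deriv y t - 1 - νt) / (y t - t)

/-- The Okamoto operator `K_{[ν0,ν1,νt,νinf;t]} y = y + (ν0+ν1+νt+νinf)/Z`. -/
noncomputable def okK (ν0 ν1 νt νinf : ℂ) (y : ℂ → ℂ) (t : ℂ) : ℂ :=
  y t + (ν0 + ν1 + νt + νinf) / okZ ν0 ν1 νt y t


/-- The Okamoto denominator determines the first derivative. -/
theorem alg_p (a b t u p z : ℂ) (h3 : u ≠ 0) (h4 : u - 1 ≠ 0)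
    (h5 : u - t ≠ 0)
    (hz : z = ((t-1) * p - (-a)) / u - (t * p + (b-1)) / (u - 1) + (p - 1 - (-b)) / (u - t)) :
    t * (t-1) * p = u*(u-1)*(u-t)*z - a*(u-1)*(u-t) + (b-1)*u*(u-t) - (b-1)*u*(u-1) := by
  subst hz
  field_simp
  ring

theorem alg_dz (a b t u p q z : ℂ) (h1 : t ≠ 0) (h2 : t - 1 ≠ 0) (h3 : u ≠ 0) (h4 : u - 1 ≠ 0)
    (h5 : u - t ≠ 0)
    (hz : z = ((t-1) * p - (-a)) / u - (t * p + (b-1)) / (u - 1) + (p - 1 - (-b)) / (u - t))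
    (hq : q = (1/2) * (1/u + 1/(u - 1) + 1/(u - t)) * p^2
    - (1/t + 1/(t-1) + 1/(u - t)) * p
    + (u * (u - 1) * (u - t) / (t^2 * (t-1)^2)) *
      (((a+1) - 1)^2/2 + (-(a^2/2)) * t/u^2 + ((b-1)^2/2) * (t-1)/(u - 1)^2
        + ((1 - b^2)/2) * (t*(t-1))/(u - t)^2)) :
    (((1 * p + (t-1) * q) * u - ((t-1) * p - (-a)) * p) / u^2
      - ((1 * p + t * q) * (u - 1) - (t * p + (b-1)) * p) / (u - 1)^2
      + (q * (u - t) - (p - 1 - (-b)) * (p - 1)) / (u - t)^2)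
    = -z*((3*u^2-2*(1+t)*u+t)*z/2 - a*(2*u-1-t) - (b-1)*(t-1)) / (t*(t-1)) := by
  subst hz hq
  field_simp
  ring

/-- From the Hamiltonian form to the sixth Painlevé equation. -/
theorem alg_final (a b T Y Y1 Y2 Q Q1 : ℂ) (h1 : T ≠ 0) (h2 : T - 1 ≠ 0) (h3 : Y ≠ 0)
    (h4 : Y - 1 ≠ 0) (h5 : Y - T ≠ 0)
    (hY1 : T*(T-1)*Y1 = 2*Y*(Y-1)*(Y-T)*Q
      - (1/2*(Y-1)*(Y-T) + a*Y*(Y-T) + (b-1)*Y*(Y-1)))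
    (hQ1 : T*(T-1)*Q1 = -((3*Y^2-2*(1+T)*Y+T)*Q^2
      - (1/2*(2*Y-1-T) + a*(2*Y-T) + (b-1)*(2*Y-1))*Q + ((a+b-1/2)^2-1/4)/4))
    (hY2 : (2*T-1)*Y1 + T*(T-1)*Y2 =
      2*(Y-1)*(Y-T)*Q*Y1 + 2*Y*(Y-T)*Q*Y1 + 2*Y*(Y-1)*Q*(Y1-1) + 2*Y*(Y-1)*(Y-T)*Q1
      - (1/2*Y1*(Y-T) + 1/2*(Y-1)*(Y1-1) + a*Y1*(Y-T) + a*Y*(Y1-1)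
          + (b-1)*Y1*(Y-1) + (b-1)*Y*Y1)) :
    Y2 = (1/2) * (1/Y + 1/(Y - 1) + 1/(Y - T)) * Y1^2
    - (1/T + 1/(T-1) + 1/(Y - T)) * Y1
    + (Y * (Y - 1) * (Y - T) / (T^2 * (T-1)^2)) *
      ((1/2 - 1)^2/2 + (-((1/2)^2/2)) * T/Y^2 + (a^2/2) * (T-1)/(Y - 1)^2
        + ((1 - b^2)/2) * (T*(T-1))/(Y - T)^2) := by
  have hQ : Q = (T*(T-1)*Y1 + (1/2*(Y-1)*(Y-T) + a*Y*(Y-T) + (b-1)*Y*(Y-1)))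
      / (2*Y*(Y-1)*(Y-T)) := by
    field_simp
    linear_combination -2 * hY1
  have hQ1' : Q1 = -((3*Y^2-2*(1+T)*Y+T)*Q^2
      - (1/2*(2*Y-1-T) + a*(2*Y-T) + (b-1)*(2*Y-1))*Q + ((a+b-1/2)^2-1/4)/4) / (T*(T-1)) := by
    rw [eq_div_iff (mul_ne_zero h1 h2)]
    linear_combination hQ1
  have hY2' : Y2 = (2*(Y-1)*(Y-T)*Q*Y1 + 2*Y*(Y-T)*Q*Y1 + 2*Y*(Y-1)*Q*(Y1-1)
      + 2*Y*(Y-1)*(Y-T)*Q1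
      - (1/2*Y1*(Y-T) + 1/2*(Y-1)*(Y1-1) + a*Y1*(Y-T) + a*Y*(Y1-1)
          + (b-1)*Y1*(Y-1) + (b-1)*Y*Y1) - (2*T-1)*Y1) / (T*(T-1)) := by
    rw [eq_div_iff (mul_ne_zero h1 h2)]
    linear_combination hY2
  rw [hY2', hQ1', hQ]
  clear hY2' hQ1' hQ hY1 hQ1 hY2
  field_simp
  ring

/-- The derivative of `w = η²`, times a nonzero factor. -/
theorem alg_w (a b t u z p z1 : ℂ) (h1 : t ≠ 0) (h2 : t - 1 ≠ 0) (hz : z ≠ 0)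
    (hp : t * (t-1) * p = u*(u-1)*(u-t)*z - a*(u-1)*(u-t) + (b-1)*u*(u-t) - (b-1)*u*(u-1))
    (hz1 : z1 = -z*((3*u^2-2*(1+t)*u+t)*z/2 - a*(2*u-1-t) - (b-1)*(t-1)) / (t*(t-1)))
    (w : ℂ) (hw : w = u - 2*a/z) :
    p + 2*a*z1/z^2 = w*(z*(w-1)*(w-t) + 2*a*w - a*(1+t) - (b-1)*(t-1))/(t*(t-1)) := by
  have hp' : p = (u*(u-1)*(u-t)*z - a*(u-1)*(u-t) + (b-1)*u*(u-t) - (b-1)*u*(u-1))/(t*(t-1)) := by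
    field_simp
    linear_combination hp
  subst hz1 hw hp'
  field_simp
  ring

/-- The derivative of the momentum `M`. -/
theorem alg_M (a b s e z u z1 e1 M : ℂ) (h1 : s ≠ 0) (h2 : s^2 - 1 ≠ 0) (hz : z ≠ 0)
    (hes : e + s ≠ 0) (hu : u = e^2 + 2*a/z)
    (hz1 : z1 = -z*((3*u^2-2*(1+s^2)*u+s^2)*z/2 - a*(2*u-1-s^2) - (b-1)*(s^2-1))
      / (s^2*(s^2-1)) * (2*s))
    (he1 : e1 = e*(z*(e^2-1)*(e^2-s^2) + 2*a*e^2 - a*(1+s^2) - (b-1)*(s^2-1))/(s*(s^2-1)))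
    (hM : M = z*e - (b-a)/(e+s)) :
    z1*e + z*e1 + (b-a)*(e1+1)/(e+s)^2
    = -(M^2*(2*e^3-(1+s^2)*e) + M*(3*(a+b)*e^2-2*(b-a)*s*e-(a+b)*s^2+s^2-1)
      + (a+b)^2*e - (a+b)*(b-a)*s)/(s*(s^2-1)) := by
  subst hz1 he1 hM hu
  field_simp
  ring

theorem alg_e (a b s e z e1 M : ℂ) (h1 : s ≠ 0) (h2 : s^2 - 1 ≠ 0)
    (hes : e + s ≠ 0)
    (he1 : e1 = e*(z*(e^2-1)*(e^2-s^2) + 2*a*e^2 - a*(1+s^2) - (b-1)*(s^2-1))/(s*(s^2-1)))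
    (hM : M = z*e - (b-a)/(e+s)) :
    e1 = (M*(e^2-1)*(e^2-s^2) + (a+b)*e^3 - (b-a)*s*e^2 + (-(a+b)*s^2+s^2-1)*e + (b-a)*s)
      /(s*(s^2-1)) := by
  subst he1 hM
  field_simp
  ring

/-- The Hamilton equation for `Y`. -/
theorem alg_Y1 (a b s e M e1 M1 Y Y1 Q T : ℂ) (h1 : s ≠ 0) (h2 : s - 1 ≠ 0) (h3 : s + 1 ≠ 0)
    (hD : M*(e-1)+(a+b) ≠ 0)
    (he1 : e1 = (M*(e^2-1)*(e^2-s^2) + (a+b)*e^3 - (b-a)*s*e^2 + (-(a+b)*s^2+s^2-1)*e + (b-a)*s)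
      /(s*(s^2-1)))
    (hM1 : M1 = -(M^2*(2*e^3-(1+s^2)*e) + M*(3*(a+b)*e^2-2*(b-a)*s*e-(a+b)*s^2+s^2-1)
      + (a+b)^2*e - (a+b)*(b-a)*s)/(s*(s^2-1)))
    (hT : T = (s+1)^2/(s-1)^2)
    (hY : Y = (s+1)*(M*(e+1)+(a+b))/((s-1)*(M*(e-1)+(a+b))))
    (hQ : Q = -(s-1)*((e-1)*(M*(e-1)+(a+b)))/(4*(s+1)))
    (hY1 : Y1 * (-4*(s+1)/(s-1)^3) =
      (((M*(e+1)+(a+b)) + (s+1)*(M1*(e+1)+M*e1))*((s-1)*(M*(e-1)+(a+b)))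
        - (s+1)*(M*(e+1)+(a+b))*((M*(e-1)+(a+b)) + (s-1)*(M1*(e-1)+M*e1)))
      / ((s-1)*(M*(e-1)+(a+b)))^2) :
    T*(T-1)*Y1 = 2*Y*(Y-1)*(Y-T)*Q
      - (1/2*(Y-1)*(Y-T) + a*Y*(Y-T) + (b-1)*Y*(Y-1)) := by
  have h4 : s^2 - 1 ≠ 0 := by
    have : s^2 - 1 = (s-1)*(s+1) := by ring
    rw [this]; exact mul_ne_zero h2 h3
  have hY1' : Y1 = (((M*(e+1)+(a+b)) + (s+1)*(M1*(e+1)+M*e1))*((s-1)*(M*(e-1)+(a+b)))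
        - (s+1)*(M*(e+1)+(a+b))*((M*(e-1)+(a+b)) + (s-1)*(M1*(e-1)+M*e1)))
      / ((s-1)*(M*(e-1)+(a+b)))^2 / (-4*(s+1)/(s-1)^3) := by
    rw [← hY1]; field_simp
  have h5 : s^2 - 1 = (s-1)*(s+1) := by ring
  rw [h5] at he1 hM1
  generalize hDD : M*(e-1)+(a+b) = D at *
  have ha : a = D - b - M*(e-1) := by rw [← hDD]; ring
  subst hY1' hY hQ hT he1 hM1
  subst ha
  clear hDD hY1 h4 h5
  field_simp
  ring

/-- The Hamilton equation for `Q`. -/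
theorem alg_Q1 (a b s e M e1 M1 Y Q Q1 T : ℂ) (h1 : s ≠ 0) (h2 : s - 1 ≠ 0) (h3 : s + 1 ≠ 0)
    (hD : M*(e-1)+(a+b) ≠ 0)
    (he1 : e1 = (M*(e^2-1)*(e^2-s^2) + (a+b)*e^3 - (b-a)*s*e^2 + (-(a+b)*s^2+s^2-1)*e + (b-a)*s)
      /(s*(s^2-1)))
    (hM1 : M1 = -(M^2*(2*e^3-(1+s^2)*e) + M*(3*(a+b)*e^2-2*(b-a)*s*e-(a+b)*s^2+s^2-1)
      + (a+b)^2*e - (a+b)*(b-a)*s)/(s*(s^2-1)))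
    (hT : T = (s+1)^2/(s-1)^2)
    (hY : Y = (s+1)*(M*(e+1)+(a+b))/((s-1)*(M*(e-1)+(a+b))))
    (hQ : Q = -(s-1)*((e-1)*(M*(e-1)+(a+b)))/(4*(s+1)))
    (hQ1 : Q1 * (-4*(s+1)/(s-1)^3) =
      ((-1*((e-1)*(M*(e-1)+(a+b)))
          + -(s-1)*(e1*(M*(e-1)+(a+b)) + (e-1)*(M1*(e-1)+M*e1)))*(4*(s+1))
        - -(s-1)*((e-1)*(M*(e-1)+(a+b)))*4) / (4*(s+1))^2) :
    T*(T-1)*Q1 = -((3*Y^2-2*(1+T)*Y+T)*Q^2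
      - (1/2*(2*Y-1-T) + a*(2*Y-T) + (b-1)*(2*Y-1))*Q + ((a+b-1/2)^2-1/4)/4) := by
  have h5 : s^2 - 1 = (s-1)*(s+1) := by ring
  have hQ1' : Q1 = ((-1*((e-1)*(M*(e-1)+(a+b)))
          + -(s-1)*(e1*(M*(e-1)+(a+b)) + (e-1)*(M1*(e-1)+M*e1)))*(4*(s+1))
        - -(s-1)*((e-1)*(M*(e-1)+(a+b)))*4) / (4*(s+1))^2 / (-4*(s+1)/(s-1)^3) := by
    rw [← hQ1]; field_simp
  rw [h5] at he1 hM1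
  generalize hDD : M*(e-1)+(a+b) = D at *
  have ha : a = D - b - M*(e-1) := by rw [← hDD]; ring
  subst hQ1' hY hQ hT he1 hM1
  subst ha
  clear hDD hQ1 h5
  field_simp
  ring

/-- If `e (e' - e H) = 0` on an open set, then `e' = e H` there. -/
theorem deriv_cancel (V : Set ℂ) (hV : IsOpen V) (e H : ℂ → ℂ)
    (he : ∀ s ∈ V, DifferentiableAt ℂ e s) (hH : ∀ s ∈ V, ContinuousAt H s)
    (h : ∀ s ∈ V, e s * (deriv e s - e s * H s) = 0) :
    ∀ s ∈ V, deriv e s = e s * H s := by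
  intro s hs
  by_contra hne
  have hd : DifferentiableOn ℂ e V := fun x hx => (he x hx).differentiableWithinAt
  have hc : ContinuousAt (deriv e) s :=
    ((hd.deriv hV).differentiableAt (hV.mem_nhds hs)).continuousAt
  have hc2 : ContinuousAt (fun x => deriv e x - e x * H x) s :=
    hc.sub ((he s hs).continuousAt.mul (hH s hs))
  have hev := hc2.eventually_ne (sub_ne_zero.mpr hne)
  have hz : e =ᶠ[nhds s] fun _ => 0 := by
    filter_upwards [hev, hV.mem_nhds hs] with x hx hxV
    exact (mul_eq_zero.mp (h x hxV)).resolve_right hx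
  apply hne
  rw [hz.deriv_eq, hz.eq_of_nhds]
  simp

theorem hasDerivAt_okZ (a b : ℂ) (U : Set ℂ) (y : ℂ → ℂ)
    (hy : IsPVISolutionOn a (b-1) b (a+1) y U) (t : ℂ) (ht : t ∈ U) :
    HasDerivAt (okZ (-a) (b-1) (-b) y)
      (-(okZ (-a) (b-1) (-b) y t)*((3*(y t)^2-2*(1+t)*(y t)+t)*(okZ (-a) (b-1) (-b) y t)/2
        - a*(2*(y t)-1-t) - (b-1)*(t-1)) / (t*(t-1))) t := by
  obtain ⟨-, h1, h2, h3⟩ := hy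
  obtain ⟨t0, t1, y0, y1, yt⟩ := h1 t ht
  obtain ⟨d1, d2⟩ := h2 t ht
  have hq := h3 t ht
  unfold PVIAt pviRHS at hq
  have D1 := d1.hasDerivAt
  have D2 := d2.hasDerivAt
  have y1' := sub_ne_zero.mpr y1
  have yt' := sub_ne_zero.mpr yt
  have key := alg_dz a b t (y t) (deriv y t) (deriv (deriv y) t) (okZ (-a) (b-1) (-b) y t)
    t0 (sub_ne_zero.mpr t1) y0 y1' yt' rfl hq
  rw [← key]
  have i := hasDerivAt_id' t
  have A := (((i.sub_const 1).mul D2).sub_const (-a)).div D1 y0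
  have B := ((i.mul D2).add_const (b-1)).div (D1.sub_const 1) y1'
  have C := ((D2.sub_const 1).sub_const (-b)).div (D1.sub i) yt'
  exact (A.sub B).add C

theorem hasDerivAt_sq (s : ℂ) : HasDerivAt (fun x : ℂ => x^2) (2*s) s := by
  simpa using hasDerivAt_pow 2 s

theorem hasDerivAt_T (s : ℂ) (h : s - 1 ≠ 0) :
    HasDerivAt (fun x : ℂ => (x+1)^2/(x-1)^2) (-4*(s+1)/(s-1)^3) s := by
  have i := hasDerivAt_id' s
  have A := ((i.add_const 1).pow 2).div ((i.sub_const 1).pow 2) (pow_ne_zero 2 h)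
  refine HasDerivAt.congr_deriv A ?_
  simp only [Pi.pow_apply]
  field_simp
  push_cast
  ring
/-- The variant quadratic transformation yielding a solution of
`P_VI(1/2,a,b,1/2;T₁)` (formula (34) of Vidunas–Kitaev). -/
theorem quadratic_transformation_variant2
    (a b : ℂ) (U : Set ℂ) (y₀ : ℂ → ℂ)
    (hy₀ : IsPVISolutionOn a (b-1) b (a+1) y₀ U)
    (hZ : ∀ t ∈ U, okZ (-a) (b-1) (-b) y₀ t ≠ 0)
    (y₁ : ℂ → ℂ) (hy₁def : ∀ t ∈ U, y₁ t = okK (-a) (b-1) (-b) (1-a) y₀ t)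
    (V : Set ℂ) (hVopen : IsOpen V)
    (hV : ∀ τ ∈ V, τ^2 ∈ U ∧ τ ≠ 0 ∧ τ ≠ 1 ∧ τ ≠ -1)
    (η : ℂ → ℂ) (hηdiff : ∀ τ ∈ V, DifferentiableAt ℂ η τ)
    (hη : ∀ τ ∈ V, (η τ)^2 = y₁ (τ^2))
    (hden : ∀ τ ∈ V,
      2*a*(η τ+τ)*(y₀ (τ^2)-η τ) + (b-a)*(τ+1)*(y₀ (τ^2)-(η τ)^2) ≠ 0)
    (Y : ℂ → ℂ) (W : Set ℂ) (hWopen : IsOpen W)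
    (hWsub : ∀ τ ∈ V, (τ+1)^2/(τ-1)^2 ∈ W)
    (hYdiff : ∀ T ∈ W, DifferentiableAt ℂ Y T ∧ DifferentiableAt ℂ (deriv Y) T)
    (hYeq : ∀ τ ∈ V, Y ((τ+1)^2/(τ-1)^2) =
      (τ+1)*(2*a*(η τ+τ)*(y₀ (τ^2)+η τ) + (b-a)*(τ-1)*(y₀ (τ^2)-(η τ)^2)) /
        ((τ-1)*(2*a*(η τ+τ)*(y₀ (τ^2)-η τ) + (b-a)*(τ+1)*(y₀ (τ^2)-(η τ)^2))))
    (havoid : ∀ τ ∈ V, (τ+1)^2/(τ-1)^2 ≠ 0 ∧ (τ+1)^2/(τ-1)^2 ≠ 1 ∧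
      Y ((τ+1)^2/(τ-1)^2) ≠ 0 ∧ Y ((τ+1)^2/(τ-1)^2) ≠ 1 ∧
      Y ((τ+1)^2/(τ-1)^2) ≠ (τ+1)^2/(τ-1)^2) :
    ∀ τ ∈ V, PVIAt (1/2) a b (1/2) Y ((τ+1)^2/(τ-1)^2) := by
  intro τ₀ hτ₀
  have hy₀' := hy₀
  obtain ⟨hUo, hUne, hUd, hUp⟩ := hy₀
  set z : ℂ → ℂ := fun s => okZ (-a) (b-1) (-b) y₀ (s^2) with hzdef
  -- basic facts on V
  have ha : a ≠ 0 := by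
    intro ha
    obtain ⟨hU, -⟩ := hV τ₀ hτ₀
    apply hden τ₀ hτ₀
    have h1 := hη τ₀ hτ₀
    rw [hy₁def _ hU] at h1
    unfold okK at h1
    subst ha
    have h2 : (-0 + (b - 1) + -b + (1 - 0) : ℂ) = 0 := by ring
    rw [h2, zero_div, add_zero] at h1
    rw [h1]; ring
  have hz0 : ∀ s ∈ V, z s ≠ 0 := fun s hs => hZ _ (hV s hs).1
  have hw : ∀ s ∈ V, (η s)^2 = y₀ (s^2) - 2*a/z s := by
    intro s hs
    rw [hη s hs, hy₁def _ (hV s hs).1]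
    unfold okK
    rw [hzdef]
    ring
  have hs0 : ∀ s ∈ V, s ≠ 0 := fun s hs => (hV s hs).2.1
  have hs1 : ∀ s ∈ V, s - 1 ≠ 0 := fun s hs => sub_ne_zero.mpr (hV s hs).2.2.1
  have hs2 : ∀ s ∈ V, s + 1 ≠ 0 := fun s hs h => (hV s hs).2.2.2 (by linear_combination h)
  have hs3 : ∀ s ∈ V, s^2 - 1 ≠ 0 := by
    intro s hs
    have : s^2 - 1 = (s-1)*(s+1) := by ring
    rw [this]; exact mul_ne_zero (hs1 s hs) (hs2 s hs)
  -- derivative of z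
  have hdz : ∀ s ∈ V, HasDerivAt z
      (-(z s)*((3*(y₀ (s^2))^2-2*(1+s^2)*(y₀ (s^2))+s^2)*(z s)/2
        - a*(2*(y₀ (s^2))-1-s^2) - (b-1)*(s^2-1)) / (s^2*(s^2-1)) * (2*s)) s := by
    intro s hs
    exact HasDerivAt.comp s (hasDerivAt_okZ a b U y₀ hy₀' (s^2) (hV s hs).1) (hasDerivAt_sq s)
  -- derivative of η
  have hde : ∀ s ∈ V, deriv η s =
      η s * ((z s*((η s)^2-1)*((η s)^2-s^2) + 2*a*(η s)^2 - a*(1+s^2) - (b-1)*(s^2-1))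
        /(s*(s^2-1))) := by
    apply deriv_cancel V hVopen η
      (fun s => (z s*((η s)^2-1)*((η s)^2-s^2) + 2*a*(η s)^2 - a*(1+s^2) - (b-1)*(s^2-1))
        /(s*(s^2-1))) hηdiff
    · intro s hs
      have c1 := (hηdiff s hs).continuousAt
      have c2 := (hdz s hs).continuousAt
      have := mul_ne_zero (hs0 s hs) (hs3 s hs)
      fun_prop (disch := assumption)
    · intro s hs
      have hU := (hV s hs).1
      obtain ⟨t0, t1, y0, y1, yt⟩ := hUne _ hU
      have D1 : HasDerivAt (fun x => (η x)^2) (2 * η s * deriv η s) s := by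
        have h := (hηdiff s hs).hasDerivAt.pow 2
        refine HasDerivAt.congr_deriv h ?_
        push_cast
        ring
      have D2 : HasDerivAt (fun x => y₀ (x^2)) (deriv y₀ (s^2) * (2*s)) s :=
        HasDerivAt.comp s (hUd _ hU).1.hasDerivAt (hasDerivAt_sq s)
      have D3 := D2.sub ((hasDerivAt_const s (2*a)).div (hdz s hs) (hz0 s hs))
      have heq : (fun x => (η x)^2) =ᶠ[nhds s] ((fun x => y₀ (x^2)) - (fun _ => 2*a) / z) := by
        filter_upwards [hVopen.mem_nhds hs] with x hx
        exact hw x hx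
      have E := D1.unique (D3.congr_of_eventuallyEq heq)
      have P := alg_p a b (s^2) (y₀ (s^2)) (deriv y₀ (s^2)) (z s) y0 (sub_ne_zero.mpr y1)
        (sub_ne_zero.mpr yt) rfl
      have K := alg_w a b (s^2) (y₀ (s^2)) (z s) (deriv y₀ (s^2)) _ t0 (hs3 s hs) (hz0 s hs) P rfl
        ((η s)^2) (hw s hs)
      have E2 : 2 * η s * deriv η s = 2*s*((η s)^2*(z s*((η s)^2-1)*((η s)^2-s^2)
          + 2*a*(η s)^2 - a*(1+s^2) - (b-1)*(s^2-1))/(s^2*(s^2-1))) := by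
        rw [E, ← K]
        ring
      have n0 := hs0 s hs
      have n3 := hs3 s hs
      have E3 : η s * deriv η s = η s * (η s * ((z s*((η s)^2-1)*((η s)^2-s^2)
          + 2*a*(η s)^2 - a*(1+s^2) - (b-1)*(s^2-1))/(s*(s^2-1)))) := by
        field_simp
        field_simp at E2
        linear_combination E2
      linear_combination E3
  have hu : ∀ s ∈ V, y₀ (s^2) = (η s)^2 + 2*a/z s := by
    intro s hs
    rw [hw s hs]; ring
  -- η + τ ≠ 0
  have hes : ∀ s ∈ V, η s + s ≠ 0 := by
    intro s hs h
    apply (havoid s hs).2.2.2.1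
    have hd := hden s hs
    rw [hYeq s hs]
    have n1 := hs1 s hs
    have n2 := hs2 s hs
    rw [div_eq_one_iff_eq (mul_ne_zero n1 hd), h]
    ring
  -- the momentum M
  set M : ℂ → ℂ := fun s => z s * η s - (b-a)/(η s + s) with hMdef
  have hD : ∀ s ∈ V, M s*(η s-1)+(a+b) ≠ 0 := by
    intro s hs h
    apply hden s hs
    have n1 := hes s hs
    have n2 := hz0 s hs
    rw [hu s hs]
    rw [hMdef] at h
    simp only at h
    field_simp at h
    field_simp
    linear_combination (2 * a) * h
  have hYM : ∀ s ∈ V, Y ((s+1)^2/(s-1)^2) =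
      (s+1)*(M s*(η s+1)+(a+b))/((s-1)*(M s*(η s-1)+(a+b))) := by
    intro s hs
    have n1 := hes s hs
    have n2 := hz0 s hs
    have n3 := hs1 s hs
    rw [hYeq s hs, div_eq_div_iff (mul_ne_zero n3 (hden s hs)) (mul_ne_zero n3 (hD s hs)), hu s hs,
      hMdef]
    simp only
    field_simp
    ring
  have hdM : ∀ s ∈ V, HasDerivAt M
      (-(M s^2*(2*η s^3-(1+s^2)*η s)
        + M s*(3*(a+b)*η s^2-2*(b-a)*s*η s-(a+b)*s^2+s^2-1)
        + (a+b)^2*η s - (a+b)*(b-a)*s)/(s*(s^2-1))) s := by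
    intro s hs
    have A := ((hdz s hs).mul (hηdiff s hs).hasDerivAt).sub
      ((hasDerivAt_const s (b-a)).div ((hηdiff s hs).hasDerivAt.add (hasDerivAt_id' s)) (hes s hs))
    have K := alg_M a b s (η s) (z s) (y₀ (s^2)) _ (deriv η s) (M s) (hs0 s hs) (hs3 s hs)
      (hz0 s hs) (hes s hs) (hu s hs) rfl (by rw [hde s hs]; ring) rfl
    rw [← K]
    refine HasDerivAt.congr_deriv A ?_
    simp only [Pi.add_apply]
    ring
  have hde' : ∀ s ∈ V, deriv η s = (M s*(η s^2-1)*(η s^2-s^2) + (a+b)*η s^3 - (b-a)*s*η s^2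
      + (-(a+b)*s^2+s^2-1)*η s + (b-a)*s) /(s*(s^2-1)) := by
    intro s hs
    exact alg_e a b s (η s) (z s) (deriv η s) (M s) (hs0 s hs) (hs3 s hs) (hes s hs)
      (by rw [hde s hs]; ring) rfl
  -- the momentum of Y
  set Q : ℂ → ℂ := fun s => -(s-1)*((η s-1)*(M s*(η s-1)+(a+b)))/(4*(s+1)) with hQdef
  set T : ℂ → ℂ := fun s => (s+1)^2/(s-1)^2 with hTdef
  have hY1 : ∀ s ∈ V, T s*(T s-1)*deriv Y (T s) = 2*Y (T s)*(Y (T s)-1)*(Y (T s)-T s)*Q s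
      - (1/2*(Y (T s)-1)*(Y (T s)-T s) + a*Y (T s)*(Y (T s)-T s) + (b-1)*Y (T s)*(Y (T s)-1)) := by
    intro s hs
    have n1 := hs1 s hs
    have De := (hηdiff s hs).hasDerivAt
    have DM := (hdM s hs)
    have i := hasDerivAt_id' s
    have F1 : HasDerivAt (fun x => Y (T x)) (deriv Y (T s) * (-4*(s+1)/(s-1)^3)) s :=
      HasDerivAt.comp s (hYdiff _ (hWsub s hs)).1.hasDerivAt (hasDerivAt_T s n1)
    have F2 := ((i.add_const 1).mul ((DM.mul (De.add_const 1)).add_const (a+b))).div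
      ((i.sub_const 1).mul ((DM.mul (De.sub_const 1)).add_const (a+b)))
      (mul_ne_zero n1 (hD s hs))
    have E := F1.unique (F2.congr_of_eventuallyEq (by
      filter_upwards [hVopen.mem_nhds hs] with x hx
      exact hYM x hx))
    refine alg_Y1 a b s (η s) (M s) (deriv η s) _ _ _ (Q s) (T s) (hs0 s hs) n1 (hs2 s hs) (hD s hs)
      (hde' s hs) rfl rfl (hYM s hs) rfl (E.trans ?_)
    simp only [Pi.mul_apply, one_mul]
  -- final step
  have n0 := hs0 τ₀ hτ₀
  have n1 := hs1 τ₀ hτ₀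
  have n2 := hs2 τ₀ hτ₀
  have De := (hηdiff τ₀ hτ₀).hasDerivAt
  have DM := hdM τ₀ hτ₀
  have i := hasDerivAt_id' τ₀
  have DT : HasDerivAt T (-4*(τ₀+1)/(τ₀-1)^3) τ₀ := hasDerivAt_T τ₀ n1
  have hT1 : (-4*(τ₀+1)/(τ₀-1)^3) ≠ 0 := by
    apply div_ne_zero _ (pow_ne_zero 3 n1)
    exact mul_ne_zero (by norm_num) n2
  have DY : HasDerivAt (fun x => Y (T x)) (deriv Y (T τ₀) * (-4*(τ₀+1)/(τ₀-1)^3)) τ₀ :=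
    HasDerivAt.comp τ₀ (hYdiff _ (hWsub τ₀ hτ₀)).1.hasDerivAt DT
  have DY1 : HasDerivAt (fun x => deriv Y (T x))
      (deriv (deriv Y) (T τ₀) * (-4*(τ₀+1)/(τ₀-1)^3)) τ₀ :=
    HasDerivAt.comp (h₂ := deriv Y) τ₀ (hYdiff _ (hWsub τ₀ hτ₀)).2.hasDerivAt DT
  have DQ := (((i.sub_const 1).neg.mul ((De.sub_const 1).mul
    ((DM.mul (De.sub_const 1)).add_const (a+b)))).div
    ((i.add_const 1).const_mul 4) (mul_ne_zero (by norm_num) n2))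
  obtain ⟨q1, hq1⟩ : ∃ q1, HasDerivAt Q (q1 * (-4*(τ₀+1)/(τ₀-1)^3)) τ₀ := by
    refine ⟨deriv Q τ₀ / (-4*(τ₀+1)/(τ₀-1)^3), ?_⟩
    rw [div_mul_cancel₀ _ hT1]
    exact DQ.differentiableAt.hasDerivAt
  have hQ1 := alg_Q1 a b τ₀ (η τ₀) (M τ₀) (deriv η τ₀) _ (Y (T τ₀)) (Q τ₀) q1 (T τ₀) n0 n1 n2
    (hD τ₀ hτ₀) (hde' τ₀ hτ₀) rfl rfl (hYM τ₀ hτ₀) rfl ((hq1.unique DQ).trans (by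
      simp only [Pi.mul_apply, Pi.neg_apply, mul_one]))
  have L := (DT.mul (DT.sub_const 1)).mul DY1
  have R := ((((DY.const_mul 2).mul (DY.sub_const 1)).mul (DY.sub DT)).mul hq1).sub
    (((((DY.sub_const 1).const_mul (1/2)).mul (DY.sub DT)).add
      ((DY.const_mul a).mul (DY.sub DT))).add ((DY.const_mul (b-1)).mul (DY.sub_const 1)))
  have E := L.unique (R.congr_of_eventuallyEq (by
      filter_upwards [hVopen.mem_nhds hτ₀] with x hx
      exact hY1 x hx))
  simp only [Pi.mul_apply, Pi.sub_apply] at E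
  obtain ⟨v0, v1, v2, v3, v4⟩ := havoid τ₀ hτ₀
  unfold PVIAt pviRHS
  refine alg_final a b (T τ₀) (Y (T τ₀)) (deriv Y (T τ₀)) _ (Q τ₀) q1 v0 (sub_ne_zero.mpr v1) v2
    (sub_ne_zero.mpr v3) (sub_ne_zero.mpr v4) (hY1 τ₀ hτ₀) hQ1 ?_
  apply mul_right_cancel₀ hT1
  linear_combination E
end

section
/- Let a, b ∈ ℂ. Suppose g₀ is a solution of P_VI(a, a, b, b; t₂) on an open set U ⊆ ℂ, and that both g₁ = K_{[−a, −a, −b, b; t₂]} g₀ and g₂ = K_{[a, a, −b, b; t₂]} g₀ are defined on U. Then for all t₂ ∈ U: (g₂(t₂)² − g₂(t₂)) · (g₀(t₂)² − 2 g₁(t₂) g₀(t₂) + g₁(t₂))² = (g₀(t₂)² − g₀(t₂))² · (g₁(t₂)² − g₁(t₂)). -/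
/-- The relation between the square roots `√(g₂²−g₂)` and `√(g₁²−g₁)`:
`(g₂²−g₂)(g₀²−2g₁g₀+g₁)² = (g₀²−g₀)²(g₁²−g₁)`. -/
theorem contiguous_relation_g2
    (a b : ℂ) (U : Set ℂ) (g₀ : ℂ → ℂ)
    (hg₀ : IsPVISolutionOn a a b b g₀ U)
    (hZ1 : ∀ t ∈ U, okZ (-a) (-a) (-b) g₀ t ≠ 0)
    (hZ2 : ∀ t ∈ U, okZ a a (-b) g₀ t ≠ 0)
    (g₁ g₂ : ℂ → ℂ)
    (hg₁def : ∀ t ∈ U, g₁ t = okK (-a) (-a) (-b) b g₀ t)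
    (hg₂def : ∀ t ∈ U, g₂ t = okK a a (-b) b g₀ t) :
    ∀ t ∈ U, ((g₂ t)^2 - g₂ t) * ((g₀ t)^2 - 2*(g₁ t)*(g₀ t) + g₁ t)^2
      = ((g₀ t)^2 - g₀ t)^2 * ((g₁ t)^2 - g₁ t) := by
  intro t ht
  obtain ⟨-, hne, -, -⟩ := hg₀
  obtain ⟨-, -, hy0, hy1, hyt⟩ := hne t ht
  have hA := hZ1 t ht
  have hB := hZ2 t ht
  have e1 := hg₁def t ht
  have e2 := hg₂def t ht
  have hy1' : g₀ t - 1 ≠ 0 := sub_ne_zero.mpr hy1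
  have hyt' : g₀ t - t ≠ 0 := sub_ne_zero.mpr hyt
  -- the two denominators differ by an explicit rational function of `g₀`
  have hAB : (okZ (-a) (-a) (-b) g₀ t - okZ a a (-b) g₀ t) * ((g₀ t)^2 - g₀ t)
      = 2 * a * (2 * g₀ t - 1) := by
    unfold okZ
    field_simp
    ring
  unfold okK at e1 e2
  generalize okZ (-a) (-a) (-b) g₀ t = A at *
  generalize okZ a a (-b) g₀ t = B at *
  generalize g₀ t = y at *
  generalize g₁ t = p at *
  generalize g₂ t = q at *
  have f1 : A * p = A * y - 2 * a := by rw [e1]; field_simp; ring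
  have f2 : B * q = B * y + 2 * a := by rw [e2]; field_simp; ring
  have h1 : A * (y^2 - 2*p*y + p) = -((y^2 - y) * B) := by
    linear_combination (1 - 2*y) * f1 - hAB
  have h2 : A^2 * (p^2 - p) = (y^2 - y) * A * B + 4 * a^2 := by
    linear_combination (A * p + A * y - 2 * a - A) * f1 + A * hAB
  have h3 : B^2 * (q^2 - q) = (y^2 - y) * A * B + 4 * a^2 := by
    linear_combination (B * q + B * y + 2 * a - B) * f2 - B * hAB
  have hne : A^2 * B^2 ≠ 0 := mul_ne_zero (pow_ne_zero 2 hA) (pow_ne_zero 2 hB)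
  apply mul_left_cancel₀ hne
  calc A^2 * B^2 * ((q^2 - q) * (y^2 - 2*p*y + p)^2)
      = (B^2 * (q^2 - q)) * (A * (y^2 - 2*p*y + p))^2 := by ring
    _ = (A^2 * (p^2 - p)) * (-((y^2 - y) * B))^2 := by rw [h3, h1, h2]
    _ = A^2 * B^2 * ((y^2 - y)^2 * (p^2 - p)) := by ring
end

section
/- Let A, B ∈ ℂ. Let U ⊆ ℂ be an open set with t ∉ {0,1} for t ∈ U, and let y : U → ℂ be a differentiable function with y(t)² = t and y(t) ∉ {0,1,t} for all t ∈ U (a branch of √t). Then y is a solution of P_VI(A/2, B/2, B/2, A/2+1; t) on U, for arbitrary A and B. -/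
/-- Any branch of `√t` solves `P_VI(A/2,B/2,B/2,A/2+1;t)` for arbitrary `A, B`. -/
theorem sqrt_t_is_solution
    (A B : ℂ) (U : Set ℂ) (hU : IsOpen U)
    (hUreg : ∀ t ∈ U, t ≠ 0 ∧ t ≠ 1)
    (y : ℂ → ℂ) (hydiff : ∀ t ∈ U, DifferentiableAt ℂ y t)
    (hy : ∀ t ∈ U, (y t)^2 = t ∧ y t ≠ 0 ∧ y t ≠ 1 ∧ y t ≠ t) :
    IsPVISolutionOn (A/2) (B/2) (B/2) (A/2+1) y U := by
  have hd : ∀ t ∈ U, deriv y t = (2 * y t)⁻¹ := by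
    intro t ht
    have h1 : HasDerivAt (fun x => (y x)^2) (2 * y t * deriv y t) t := by
      simpa using (hydiff t ht).hasDerivAt.fun_pow 2
    have h2 : HasDerivAt (fun x => (y x)^2) 1 t := by
      refine (hasDerivAt_id t).congr_of_eventuallyEq ?_
      filter_upwards [hU.mem_nhds ht] with x hx
      exact (hy x hx).1
    exact eq_inv_of_mul_eq_one_right (h1.unique h2)
  have hdd : ∀ t ∈ U, HasDerivAt (deriv y) (-(2 * (2 * y t)⁻¹) / (2 * y t)^2) t := by
    intro t ht
    have h0 : 2 * y t ≠ 0 := mul_ne_zero two_ne_zero (hy t ht).2.1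
    have h1 := (hydiff t ht).hasDerivAt
    rw [hd t ht] at h1
    refine ((h1.const_mul 2).fun_inv h0).congr_of_eventuallyEq ?_
    filter_upwards [hU.mem_nhds ht] with x hx
    exact hd x hx
  refine ⟨hU, fun t ht => ⟨(hUreg t ht).1, (hUreg t ht).2, (hy t ht).2⟩,
    fun t ht => ⟨hydiff t ht, (hdd t ht).differentiableAt⟩, fun t ht => ?_⟩
  unfold PVIAt pviRHS
  rw [(hdd t ht).deriv, hd t ht]
  obtain ⟨hs, h0, h1, -⟩ := hy t ht
  have ht1 := (hUreg t ht).2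
  generalize y t = s at *
  subst hs
  have e1 : s - 1 ≠ 0 := sub_ne_zero.2 h1
  have e2 : s + 1 ≠ 0 := by
    intro h
    apply ht1
    linear_combination (s - 1) * h
  have r1 : s - s^2 = -(s * (s - 1)) := by ring
  have r2 : s^2 - 1 = (s - 1) * (s + 1) := by ring
  rw [r1, r2]
  field_simp
  ring
end

section
/- Define t(s) = s³(s+2)/(2s+1) for s ∈ ℂ with 2s+1 ≠ 0. Let s₀ ∈ ℂ be such that t'(s₀) ≠ 0, t(s₀) ∉ {0,1}, and −s₀ ∉ {0, 1, t(s₀)}. Suppose V is an open neighbourhood of s₀ and Y is a function, twice differentiable on an open neighbourhood of t(s₀), such that Y(t(s)) = −s for all s ∈ V, with t(s) ∉ {0,1} and Y(t(s)) ∉ {0,1,t(s)} for s ∈ V. Then Y is a solution of P_VI(1/2, 1/2, 1/2, 1/2; t) on a neighbourhood of t(s₀) (Hitchin's algebraic solution y = −s, t = s³(s+2)/(2s+1)). -/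
theorem hitchin_deriv_t (t : ℂ → ℂ) (ht : ∀ s, t s = s^3*(s+2)/(2*s+1))
    (s : ℂ) (hs : 2*s+1 ≠ 0) :
    HasStrictDerivAt t (6*s^2*(s+1)^2/(2*s+1)^2) s := by
  have h1 : HasStrictDerivAt (fun x : ℂ => 2*x+1) 2 s := by
    simpa using ((hasStrictDerivAt_id s).const_mul 2).add_const 1
  have h2 : HasStrictDerivAt (fun x : ℂ => x^3) (3*s^2) s := by
    simpa using hasStrictDerivAt_pow 3 s
  have h3 : HasStrictDerivAt (fun x : ℂ => x+2) 1 s := by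
    simpa using (hasStrictDerivAt_id s).add_const 2
  have h4 := (h2.mul h3).div h1 hs
  have e : t = ((fun x : ℂ => x^3) * (fun x : ℂ => x+2)) / (fun x : ℂ => 2*x+1) := by
    funext x; simp [ht]
  rw [e]
  refine h4.congr_deriv ?_
  simp only [Pi.mul_apply]
  field_simp
  ring

theorem hitchin_deriv_p (s : ℂ) (h0 : s ≠ 0) (h1 : s + 1 ≠ 0) :
    HasDerivAt (fun s : ℂ => -(2*s+1)^2/(6*(s^2*(s+1)^2)))
      ((2*s+1)*(2*s^2+2*s+1)/(3*(s^3*(s+1)^3))) s := by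
  have a1 : HasDerivAt (fun x : ℂ => 2*x+1) 2 s := by
    simpa using ((hasDerivAt_id s).const_mul 2).add_const 1
  have a2 : HasDerivAt (fun x : ℂ => x+1) 1 s := by
    simpa using (hasDerivAt_id s).add_const 1
  have hne : 6*(s^2*(s+1)^2) ≠ 0 := by simp [h0, h1]
  have h4 := (a1.fun_pow 2).fun_neg.fun_div
    ((((hasDerivAt_id' s).fun_pow 2).fun_mul (a2.fun_pow 2)).const_mul 6) hne
  refine h4.congr_deriv ?_
  field_simp
  ring

theorem hitchin_alg (s : ℂ) (hs : 2*s+1 ≠ 0) (h0 : s ≠ 0) (h1 : s + 1 ≠ 0)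
    (h2 : s + 2 ≠ 0) (h3 : s - 1 ≠ 0) (h4 : s^2+s+1 ≠ 0) (y T p q : ℂ)
    (hy : y = -s) (hT : T = s^3*(s+2)/(2*s+1))
    (hp : p = -(2*s+1)^2/(6*(s^2*(s+1)^2)))
    (hq : q = (2*s+1)^3*(2*s^2+2*s+1)/(18*(s^5*(s+1)^5))) :
    q = (1/2) * (1/y + 1/(y - 1) + 1/(y - T)) * p^2
    - (1/T + 1/(T-1) + 1/(y - T)) * p
    + (y * (y - 1) * (y - T) / (T^2 * (T-1)^2)) *
      ((1/2 - 1)^2/2 + (-((1/2)^2/2)) * T/y^2 + ((1/2)^2/2) * (T-1)/(y - 1)^2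
        + ((1 - (1/2)^2)/2) * (T*(T-1))/(y - T)^2) := by
  have hs2 : s*2+1 ≠ 0 := by rwa [mul_comm s 2]
  have h42 : s*(s+1)+1 ≠ 0 := fun h => h4 (by linear_combination h)
  have e1 : T - 1 = (s-1)*(s+1)^3/(2*s+1) := by rw [hT]; field_simp; ring
  have e2 : y - T = -(s*(s+1)*(s^2+s+1)/(2*s+1)) := by rw [hT, hy]; field_simp; ring
  have e3 : y - 1 = -(s+1) := by rw [hy]; ring
  rw [e1, e2, e3, hT, hy, hp, hq]
  field_simp
  ring

/-- Hitchin's algebraic solution `y = −s`, `t = s³(s+2)/(2s+1)` of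
`P_VI(1/2,1/2,1/2,1/2;t)`. -/
theorem hitchin_algebraic_solution
    (t : ℂ → ℂ) (ht : ∀ s, t s = s^3*(s+2)/(2*s+1))
    (s₀ : ℂ) (hs₀ : 2*s₀+1 ≠ 0)
    (hder : deriv t s₀ ≠ 0)
    (ht0 : t s₀ ≠ 0) (ht1 : t s₀ ≠ 1)
    (hy0 : -s₀ ≠ 0) (hy1 : -s₀ ≠ 1) (hyt : -s₀ ≠ t s₀)
    (V : Set ℂ) (hVopen : IsOpen V) (hs₀V : s₀ ∈ V)
    (Y : ℂ → ℂ) (W : Set ℂ) (hWopen : IsOpen W) (hW : t s₀ ∈ W)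
    (hYdiff : ∀ T ∈ W, DifferentiableAt ℂ Y T ∧ DifferentiableAt ℂ (deriv Y) T)
    (hYeq : ∀ s ∈ V, Y (t s) = -s)
    (havoid : ∀ s ∈ V, t s ≠ 0 ∧ t s ≠ 1 ∧
      Y (t s) ≠ 0 ∧ Y (t s) ≠ 1 ∧ Y (t s) ≠ t s) :
    ∃ W' : Set ℂ, IsOpen W' ∧ t s₀ ∈ W' ∧
      IsPVISolutionOn (1/2) (1/2) (1/2) (1/2) Y W' := by
  have hder0 := hitchin_deriv_t t ht
  have hs0 : s₀ ≠ 0 := by simpa using hy0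
  have hs1 : s₀ + 1 ≠ 0 := fun h => hy1 (by linear_combination -h)
  -- a good open neighbourhood of s₀
  let G : Set ℂ := {s | s ∈ V ∧ 2*s+1 ≠ 0 ∧ s ≠ 0 ∧ s + 1 ≠ 0 ∧ t s ∈ W}
  have hGev : ∀ s ∈ G, ∀ᶠ x in nhds s, x ∈ G := by
    rintro s ⟨a, b, c, d, e⟩
    have c1 : ContinuousAt (fun x : ℂ => 2*x+1) s := by fun_prop
    have c2 : ContinuousAt (fun x : ℂ => x+1) s := by fun_prop
    filter_upwards [hVopen.mem_nhds a, c1.eventually_ne b, eventually_ne_nhds c,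
      c2.eventually_ne d,
      (hder0 s b).hasDerivAt.continuousAt.eventually_mem (hWopen.mem_nhds e)]
      with x h1 h2 h3 h4 h5
    exact ⟨h1, h2, h3, h4, h5⟩
  have hs₀G : s₀ ∈ G := ⟨hs₀V, hs₀, hs0, hs1, hW⟩
  have hY1 : ∀ s ∈ G, deriv Y (t s) = -(2*s+1)^2/(6*(s^2*(s+1)^2)) := by
    intro s hs
    have hs' := hs
    obtain ⟨a, b, c, d, e⟩ := hs'
    have b2 : s*2+1 ≠ 0 := by rwa [mul_comm s 2]
    have k1 := (hYdiff _ e).1.hasDerivAt.comp s (hder0 s b).hasDerivAt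
    have k2 : HasDerivAt (Y ∘ t) (-1) s := by
      refine (hasDerivAt_id' s).fun_neg.congr_of_eventuallyEq ?_
      filter_upwards [hGev s hs] with x hx
      exact hYeq x hx.1
    have k3 := k1.unique k2
    field_simp at k3 ⊢
    linear_combination k3
  have hY2 : ∀ s ∈ G, deriv (deriv Y) (t s)
      = (2*s+1)^3*(2*s^2+2*s+1)/(18*(s^5*(s+1)^5)) := by
    intro s hs
    have hs' := hs
    obtain ⟨a, b, c, d, e⟩ := hs'
    have b2 : s*2+1 ≠ 0 := by rwa [mul_comm s 2]
    have k1 := (hYdiff _ e).2.hasDerivAt.comp s (hder0 s b).hasDerivAt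
    have k2 : HasDerivAt (deriv Y ∘ t) ((2*s+1)*(2*s^2+2*s+1)/(3*(s^3*(s+1)^3))) s := by
      refine (hitchin_deriv_p s c d).congr_of_eventuallyEq ?_
      filter_upwards [hGev s hs] with x hx
      exact hY1 x hx
    have k3 := k1.unique k2
    field_simp at k3 ⊢
    linear_combination k3
  have hmap := (hder0 s₀ hs₀).map_nhds_eq
    (by rw [← (hder0 s₀ hs₀).hasDerivAt.deriv]; exact hder)
  have himg : t '' G ∈ nhds (t s₀) := by
    rw [← hmap]
    exact Filter.image_mem_map (hGev s₀ hs₀G)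
  refine ⟨interior (t '' G), isOpen_interior, mem_interior_iff_mem_nhds.2 himg,
    isOpen_interior, ?_, ?_, ?_⟩
  · intro T hT
    obtain ⟨s, hs, rfl⟩ := interior_subset hT
    exact havoid s hs.1
  · intro T hT
    obtain ⟨s, hs, rfl⟩ := interior_subset hT
    exact hYdiff _ hs.2.2.2.2
  · intro T hT
    obtain ⟨s, hs, rfl⟩ := interior_subset hT
    obtain ⟨n1, n2, n3, n4, n5⟩ := havoid s hs.1
    have hs' := hs
    obtain ⟨a, b, c, d, e⟩ := hs'
    have b2 : s*2+1 ≠ 0 := by rwa [mul_comm s 2]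
    have hy := hYeq s a
    refine hitchin_alg s b c d ?_ ?_ ?_ _ _ _ _ hy (ht s) (hY1 s hs) (hY2 s hs)
    · intro h; apply n1; rw [ht, h]; simp
    · intro h; apply n2; rw [ht]; field_simp
      linear_combination (s+1)^3 * h
    · intro h; apply n5; rw [hy, ht]; field_simp
      linear_combination (-(s+1)) * h
end

section
/- Let V ⊆ ℂ be open and let Vq : V → ℂ be a differentiable function with Vq(q)² = −(q²+1)(q²+5)(q²−4) for all q ∈ V (a branch on the hyperelliptic curve V² = −(q²+1)(q²+5)(q²−4)). Define on V: t₄₇(q) = 1/2 − (q¹⁴+17q¹²+111q¹⁰+370q⁸+815q⁶+1077q⁴+169q²+32)·Vq(q) / (108 q² (q²+1)³ (q²+5)²), and y₄₇(q) = 1/2 − (q²−1)²(q⁴+7q²+16)(q⁴+7q²+1)(q⁸+8q⁶+28q⁴+36q²−10) / (6 q (q²+1)² (q²+2)(q²+5)(q⁸+8q⁶+60q⁴+176q²−2)) − (5q¹⁴+85q¹²+555q¹⁰+1715q⁸+2590q⁶+1902q⁴+1574q²+322)·Vq(q) / (6 (q²+1)² (q²+2)(q²+5)(q⁸+8q⁶+60q⁴+176q²−2)),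 assuming all denominators are nonzero on V. Let q₀ ∈ V with t₄₇'(q₀) ≠ 0, t₄₇(q₀) ∉ {0,1}, and y₄₇(q₀) ∉ {0, 1, t₄₇(q₀)}. Suppose Y is twice differentiable on a neighbourhood of t₄₇(q₀) with Y(t₄₇(q)) = y₄₇(q) for q near q₀, avoiding 0, 1 and its argument. Then Y is a solution of P_VI(1/2, 1/2, 1/3, 4/5; t) on a neighbourhood of t₄₇(q₀) (an icosahedral algebraic Painlevé VI solution of Boalch type 47). -/
set_option maxHeartbeats 4000000
set_option linter.unusedVariables false
set_option linter.unusedSimpArgs false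

lemma rep_mul_ee {x y a b c a' b' c' A B C k q s U G : ℂ} (_hq : q^2 = s) (hU : U^2 = G)
    (hx : x * c = a + b * U) (hy : y * c' = a' + b' * U) (hk : k ≠ 0)
    (hA : k * A = a*a' + b*b'*G) (hB : k * B = a*b' + a'*b) (hC : k * C = c*c') :
    x * y * C = A + B * U := by
  apply mul_left_cancel₀ hk
  linear_combination (x*y)*hC + (y*c')*hx + (a+b*U)*hy + b*b'*hU - hA - U*hB

lemma rep_mul_eo {x y a b c a' b' c' A B C k q s U G : ℂ} (_hq : q^2 = s) (hU : U^2 = G)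
    (hx : x * c = a + b * U) (hy : y * q * c' = a' + b' * U) (hk : k ≠ 0)
    (hA : k * A = a*a' + b*b'*G) (hB : k * B = a*b' + a'*b) (hC : k * C = c*c') :
    x * y * q * C = A + B * U := by
  apply mul_left_cancel₀ hk
  linear_combination (x*y*q)*hC + (y*q*c')*hx + (a+b*U)*hy + b*b'*hU - hA - U*hB

lemma rep_mul_oo {x y a b c a' b' c' A B C k q s U G : ℂ} (hq : q^2 = s) (hU : U^2 = G)
    (hx : x * q * c = a + b * U) (hy : y * q * c' = a' + b' * U) (hk : k ≠ 0)
    (hA : k * A = a*a' + b*b'*G) (hB : k * B = a*b' + a'*b) (hC : k * C = c*c'*s) :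
    x * y * C = A + B * U := by
  apply mul_left_cancel₀ hk
  linear_combination (x*y)*hC + (y*q*c')*hx + (a+b*U)*hy + b*b'*hU - hA - U*hB - x*y*c*c'*hq

lemma rep_uu (q s U u : ℂ) (hq : q^2 = s) (hU : U^2 = -(s*(s+1)*(s+5)*(s-4)))
    (h0 : s ≠ 0) (h1 : s+1 ≠ 0) (h2 : s+2 ≠ 0) (h5 : s+5 ≠ 0) (hO : s^4+8*s^3+60*s^2+176*s-2 ≠ 0) (hm1 : s-1 ≠ 0) (hX2 : s^2+7*s+16 ≠ 0) (hX3 : s^2+7*s+1 ≠ 0)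
    (hx : u * q * ((s+1)^2*(s+5)*(s+2)*(s^4+8*s^3+60*s^2+176*s-2)) = (-1/3)*(s-1)^2*(s^2+7*s+16)*(s^2+7*s+1)*(s^4+8*s^3+28*s^2+36*s-10) + (-1/3)*(5*s^7+85*s^6+555*s^5+1715*s^4+2590*s^3+1902*s^2+1574*s+322) * U)
    (hy : u * q * ((s+1)^2*(s+5)*(s+2)*(s^4+8*s^3+60*s^2+176*s-2)) = (-1/3)*(s-1)^2*(s^2+7*s+16)*(s^2+7*s+1)*(s^4+8*s^3+28*s^2+36*s-10) + (-1/3)*(5*s^7+85*s^6+555*s^5+1715*s^4+2590*s^3+1902*s^2+1574*s+322) * U) :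
    u * u * (s*(s+1)^4*(s+5)^2*(s+2)^2*(s^4+8*s^3+60*s^2+176*s-2)^2) = (1/9)*(s^20+40*s^19+701*s^18+6990*s^17+42701*s^16+157852*s^15+323811*s^14+514202*s^13+3886246*s^12+27955432*s^11+113179116*s^10+288839652*s^9+495607692*s^8+588921088*s^7+505418156*s^6+365375160*s^5+250826296*s^4+91056896*s^3+20684752*s^2+2167760*s+25600) + (2/9)*(s-1)^2*(s^2+7*s+16)*(s^2+7*s+1)*(5*s^11+125*s^10+1375*s^9+8715*s^8+34860*s^7+89772*s^6+145500*s^5+142260*s^4+89220*s^3+46660*s^2-4148*s-3220) * U := by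
  refine rep_mul_oo (k := (1)) hq hU hx hy ?_ ?_ ?_ ?_
  · simp [h0, h1, h2, h5, hO, hm1, hX2, hX3]
  · ring
  · ring
  · ring

lemma rep_g (q s U w p : ℂ) (hq : q^2 = s) (hU : U^2 = -(s*(s+1)*(s+5)*(s-4)))
    (h0 : s ≠ 0) (h1 : s+1 ≠ 0) (h2 : s+2 ≠ 0) (h5 : s+5 ≠ 0) (hO : s^4+8*s^3+60*s^2+176*s-2 ≠ 0) (hm1 : s-1 ≠ 0) (hX2 : s^2+7*s+16 ≠ 0) (hX3 : s^2+7*s+1 ≠ 0)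
    (hx : w * q * (s*(s+1)^3*(s+5)^2*(s+2)*(s^4+8*s^3+60*s^2+176*s-2)) = (-1/6)*s*(s+1)*(s+5)*(s-1)^2*(s^2+7*s+16)*(s^2+7*s+1)*(s^4+8*s^3+28*s^2+36*s-10) + (1/108)*(s-4)*(s-1)^2*(s^2+7*s+16)*(s^2+7*s+1)*(s^5+19*s^4+124*s^3+332*s^2+278*s+2) * U)
    (hy : p * q * ((s-1)^3*(s^2+7*s+16)^2*(s^2+7*s+1)) = (-6/5)*s*(s+1)^2*(s+5)*(s^4+8*s^3+36*s^2+71*s-8) + (18/5)*s*(s+1)^2*(s+5)^2 * U) :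
    w * p * (s*(s+1)*(s+5)) = (1/6)*s*(s+1)*(s+5) + (-1/90)*(s^2+7*s+1) * U := by
  refine rep_mul_oo (k := s*(s+1)^2*(s+5)*(s+2)*(s^4+8*s^3+60*s^2+176*s-2)*(s-1)^3*(s^2+7*s+16)^2*(s^2+7*s+1)) hq hU hx hy ?_ ?_ ?_ ?_
  · simp [h0, h1, h2, h5, hO, hm1, hX2, hX3]
  · ring
  · ring
  · ring

lemma rep_h (q s U f p : ℂ) (hq : q^2 = s) (hU : U^2 = -(s*(s+1)*(s+5)*(s-4)))
    (h0 : s ≠ 0) (h1 : s+1 ≠ 0) (h2 : s+2 ≠ 0) (h5 : s+5 ≠ 0) (hO : s^4+8*s^3+60*s^2+176*s-2 ≠ 0) (hm1 : s-1 ≠ 0) (hX2 : s^2+7*s+16 ≠ 0) (hX3 : s^2+7*s+1 ≠ 0)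
    (hx : f * (s*(s+1)^4*(s+5)^2*(s+2)^2*(s^4+8*s^3+60*s^2+176*s-2)^2) = (1/36)*(s-1)^2*(s^2+7*s+16)*(s^2+7*s+1)*(s^14+28*s^13+326*s^12+1976*s^11+6097*s^10+6152*s^9-6384*s^8+54288*s^7+464976*s^6+1354352*s^5+2119016*s^4+1825888*s^3+658612*s^2+126560*s+1600) + (1/18)*(s-1)^2*(s^2+7*s+16)*(s^2+7*s+1)*(5*s^11+125*s^10+1375*s^9+8715*s^8+34860*s^7+89772*s^6+145500*s^5+142260*s^4+89220*s^3+46660*s^2-4148*s-3220) * U)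
    (hy : p * q * ((s-1)^3*(s^2+7*s+16)^2*(s^2+7*s+1)) = (-6/5)*s*(s+1)^2*(s+5)*(s^4+8*s^3+36*s^2+71*s-8) + (18/5)*s*(s+1)^2*(s+5)^2 * U) :
    f * p * q * ((s+1)^2*(s+5)*(s+2)*(s^4+8*s^3+60*s^2+176*s-2)) = (-1/30)*(s^2+7*s+1)*(s^8+13*s^7+59*s^6+55*s^5-354*s^4-1206*s^3-1214*s^2-70*s-200) + (-1/30)*(7*s^7+119*s^6+793*s^5+2597*s^4+4518*s^3+4094*s^2+2022*s+430) * U := by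
  refine rep_mul_eo (k := s*(s+1)^2*(s+5)*(s+2)*(s^4+8*s^3+60*s^2+176*s-2)*(s-1)^3*(s^2+7*s+16)^2*(s^2+7*s+1)) hq hU hx hy ?_ ?_ ?_ ?_
  · simp [h0, h1, h2, h5, hO, hm1, hX2, hX3]
  · ring
  · ring
  · ring

lemma rep_m (q s U u p : ℂ) (hq : q^2 = s) (hU : U^2 = -(s*(s+1)*(s+5)*(s-4)))
    (h0 : s ≠ 0) (h1 : s+1 ≠ 0) (h2 : s+2 ≠ 0) (h5 : s+5 ≠ 0) (hO : s^4+8*s^3+60*s^2+176*s-2 ≠ 0) (hm1 : s-1 ≠ 0) (hX2 : s^2+7*s+16 ≠ 0) (hX3 : s^2+7*s+1 ≠ 0)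
    (hx : u * q * ((s+1)^2*(s+5)*(s+2)*(s^4+8*s^3+60*s^2+176*s-2)) = (-1/3)*(s-1)^2*(s^2+7*s+16)*(s^2+7*s+1)*(s^4+8*s^3+28*s^2+36*s-10) + (-1/3)*(5*s^7+85*s^6+555*s^5+1715*s^4+2590*s^3+1902*s^2+1574*s+322) * U)
    (hy : p * q * ((s-1)^3*(s^2+7*s+16)^2*(s^2+7*s+1)) = (-6/5)*s*(s+1)^2*(s+5)*(s^4+8*s^3+36*s^2+71*s-8) + (18/5)*s*(s+1)^2*(s+5)^2 * U) :
    u * p * ((s-1)^3*(s^2+7*s+16)^2*(s^2+7*s+1)) = (2/5)*(s^9+18*s^8+118*s^7+296*s^6-165*s^5-2138*s^4-3244*s^3-744*s^2-1598*s-320) + (4/5)*(s^6+15*s^5+87*s^4+229*s^3+264*s^2+30*s+22) * U := by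
  refine rep_mul_oo (k := s*(s+1)^2*(s+5)*(s+2)*(s^4+8*s^3+60*s^2+176*s-2)) hq hU hx hy ?_ ?_ ?_ ?_
  · simp [h0, h1, h2, h5, hO, hm1, hX2, hX3]
  · ring
  · ring
  · ring

lemma rep_uw (q s U u w : ℂ) (hq : q^2 = s) (hU : U^2 = -(s*(s+1)*(s+5)*(s-4)))
    (h0 : s ≠ 0) (h1 : s+1 ≠ 0) (h2 : s+2 ≠ 0) (h5 : s+5 ≠ 0) (hO : s^4+8*s^3+60*s^2+176*s-2 ≠ 0) (hm1 : s-1 ≠ 0) (hX2 : s^2+7*s+16 ≠ 0) (hX3 : s^2+7*s+1 ≠ 0)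
    (hx : u * q * ((s+1)^2*(s+5)*(s+2)*(s^4+8*s^3+60*s^2+176*s-2)) = (-1/3)*(s-1)^2*(s^2+7*s+16)*(s^2+7*s+1)*(s^4+8*s^3+28*s^2+36*s-10) + (-1/3)*(5*s^7+85*s^6+555*s^5+1715*s^4+2590*s^3+1902*s^2+1574*s+322) * U)
    (hy : w * q * (s*(s+1)^3*(s+5)^2*(s+2)*(s^4+8*s^3+60*s^2+176*s-2)) = (-1/6)*s*(s+1)*(s+5)*(s-1)^2*(s^2+7*s+16)*(s^2+7*s+1)*(s^4+8*s^3+28*s^2+36*s-10) + (1/108)*(s-4)*(s-1)^2*(s^2+7*s+16)*(s^2+7*s+1)*(s^5+19*s^4+124*s^3+332*s^2+278*s+2) * U) :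
    u * w * (s^2*(s+1)^5*(s+5)^3*(s+2)^2*(s^4+8*s^3+60*s^2+176*s-2)^2) = (1/324)*s*(s+1)*(s+5)*(s-1)^2*(s^2+7*s+16)*(s^2+7*s+1)*(23*s^14+644*s^13+7748*s^12+51550*s^11+200725*s^10+440878*s^9+499584*s^8+694308*s^7+3531432*s^6+10874104*s^5+17959120*s^4+16960000*s^3+6835460*s^2+1426712*s+39104) + (-1/324)*(s-1)^2*(s^2+7*s+16)*(s^2+7*s+1)*(s^16+35*s^15+421*s^14+1136*s^13-23565*s^12-311941*s^11-1934325*s^10-7345454*s^9-17905764*s^8-27446980*s^7-25288760*s^6-16473520*s^5-14919980*s^4-9039420*s^3+1174300*s^2+469752*s+1280) * U := by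
  refine rep_mul_oo (k := (1)) hq hU hx hy ?_ ?_ ?_ ?_
  · simp [h0, h1, h2, h5, hO, hm1, hX2, hX3]
  · ring
  · ring
  · ring

lemma rep_hw (q s U h w : ℂ) (hq : q^2 = s) (hU : U^2 = -(s*(s+1)*(s+5)*(s-4)))
    (h0 : s ≠ 0) (h1 : s+1 ≠ 0) (h2 : s+2 ≠ 0) (h5 : s+5 ≠ 0) (hO : s^4+8*s^3+60*s^2+176*s-2 ≠ 0) (hm1 : s-1 ≠ 0) (hX2 : s^2+7*s+16 ≠ 0) (hX3 : s^2+7*s+1 ≠ 0)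
    (hx : h * q * ((s+1)^2*(s+5)*(s+2)*(s^4+8*s^3+60*s^2+176*s-2)) = (-1/30)*(s^2+7*s+1)*(s^8+13*s^7+59*s^6+55*s^5-354*s^4-1206*s^3-1214*s^2-70*s-200) + (-1/30)*(7*s^7+119*s^6+793*s^5+2597*s^4+4518*s^3+4094*s^2+2022*s+430) * U)
    (hy : w * q * (s*(s+1)^3*(s+5)^2*(s+2)*(s^4+8*s^3+60*s^2+176*s-2)) = (-1/6)*s*(s+1)*(s+5)*(s-1)^2*(s^2+7*s+16)*(s^2+7*s+1)*(s^4+8*s^3+28*s^2+36*s-10) + (1/108)*(s-4)*(s-1)^2*(s^2+7*s+16)*(s^2+7*s+1)*(s^5+19*s^4+124*s^3+332*s^2+278*s+2) * U) :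
    h * w * (s^2*(s+1)^5*(s+5)^3*(s+2)^2*(s^4+8*s^3+60*s^2+176*s-2)^2) = (1/3240)*s*(s+1)*(s+5)*(s-1)^2*(s^2+7*s+16)*(s^2+7*s+1)*(25*s^14+700*s^13+8120*s^12+48530*s^11+138215*s^10-626*s^9-1218288*s^8-3154728*s^7-568536*s^6+12097880*s^5+26100944*s^4+24123592*s^3+9710572*s^2+2105464*s+49760) + (-1/3240)*(s-1)^2*(s^2+7*s+16)*(s^2+7*s+1)*(s^16+35*s^15+373*s^14-364*s^13-44245*s^12-476893*s^11-2777973*s^10-10259458*s^9-24914352*s^8-39260128*s^7-38043944*s^6-20785048*s^5-6098516*s^4+406972*s^3+2747932*s^2+620760*s+1600) * U := by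
  refine rep_mul_oo (k := (1)) hq hU hx hy ?_ ?_ ?_ ?_
  · simp [h0, h1, h2, h5, hO, hm1, hX2, hX3]
  · ring
  · ring
  · ring

lemma rep_mg (q s U m g : ℂ) (hq : q^2 = s) (hU : U^2 = -(s*(s+1)*(s+5)*(s-4)))
    (h0 : s ≠ 0) (h1 : s+1 ≠ 0) (h2 : s+2 ≠ 0) (h5 : s+5 ≠ 0) (hO : s^4+8*s^3+60*s^2+176*s-2 ≠ 0) (hm1 : s-1 ≠ 0) (hX2 : s^2+7*s+16 ≠ 0) (hX3 : s^2+7*s+1 ≠ 0)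
    (hx : m * ((s-1)^3*(s^2+7*s+16)^2*(s^2+7*s+1)) = (2/5)*(s^9+18*s^8+118*s^7+296*s^6-165*s^5-2138*s^4-3244*s^3-744*s^2-1598*s-320) + (4/5)*(s^6+15*s^5+87*s^4+229*s^3+264*s^2+30*s+22) * U)
    (hy : g * (s*(s+1)*(s+5)) = (1/6)*s*(s+1)*(s+5) + (-1/90)*(s^2+7*s+1) * U) :
    m * g * (s*(s+1)*(s+5)*(s-1)^3*(s^2+7*s+16)^2*(s^2+7*s+1)) = (1/225)*s*(s+1)*(s+5)*(17*s^9+306*s^8+1980*s^7+4602*s^6-5391*s^5-43488*s^4-64524*s^3-14760*s^2-25398*s-4976) + (-1/225)*(s^11+25*s^10+215*s^9+510*s^8-3435*s^7-27777*s^6-80565*s^5-108360*s^4-55710*s^3-20710*s^2-7138*s-320) * U := by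
  refine rep_mul_ee (k := (1)) hq hU hx hy ?_ ?_ ?_ ?_
  · simp [h0, h1, h2, h5, hO, hm1, hX2, hX3]
  · ring
  · ring
  · ring

lemma rep_hp (q s U h p : ℂ) (hq : q^2 = s) (hU : U^2 = -(s*(s+1)*(s+5)*(s-4)))
    (h0 : s ≠ 0) (h1 : s+1 ≠ 0) (h2 : s+2 ≠ 0) (h5 : s+5 ≠ 0) (hO : s^4+8*s^3+60*s^2+176*s-2 ≠ 0) (hm1 : s-1 ≠ 0) (hX2 : s^2+7*s+16 ≠ 0) (hX3 : s^2+7*s+1 ≠ 0)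
    (hx : h * q * ((s+1)^2*(s+5)*(s+2)*(s^4+8*s^3+60*s^2+176*s-2)) = (-1/30)*(s^2+7*s+1)*(s^8+13*s^7+59*s^6+55*s^5-354*s^4-1206*s^3-1214*s^2-70*s-200) + (-1/30)*(7*s^7+119*s^6+793*s^5+2597*s^4+4518*s^3+4094*s^2+2022*s+430) * U)
    (hy : p * q * ((s-1)^3*(s^2+7*s+16)^2*(s^2+7*s+1)) = (-6/5)*s*(s+1)^2*(s+5)*(s^4+8*s^3+36*s^2+71*s-8) + (18/5)*s*(s+1)^2*(s+5)^2 * U) :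
    h * p * ((s-1)^3*(s^2+7*s+16)^2*(s^2+7*s+1)) = (1/25)*(s^9+18*s^8+112*s^7+200*s^6-715*s^5-3714*s^4-6182*s^3-4028*s^2-2140*s-400) + (2/25)*(2*s^6+30*s^5+170*s^4+435*s^3+525*s^2+187*s+55) * U := by
  refine rep_mul_oo (k := s*(s+1)^2*(s+5)*(s+2)*(s^4+8*s^3+60*s^2+176*s-2)) hq hU hx hy ?_ ?_ ?_ ?_
  · simp [h0, h1, h2, h5, hO, hm1, hX2, hX3]
  · ring
  · ring
  · ring

lemma rep_f (q s U u f : ℂ) (hq : q^2 = s) (hU : U^2 = -(s*(s+1)*(s+5)*(s-4)))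
    (h0 : s ≠ 0) (h1 : s+1 ≠ 0) (h2 : s+2 ≠ 0) (h5 : s+5 ≠ 0) (hO : s^4+8*s^3+60*s^2+176*s-2 ≠ 0) (hm1 : s-1 ≠ 0) (hX2 : s^2+7*s+16 ≠ 0) (hX3 : s^2+7*s+1 ≠ 0)
    (hf : 4*f = u*u-1)
    (hx : u * q * ((s+1)^2*(s+5)*(s+2)*(s^4+8*s^3+60*s^2+176*s-2)) = (-1/3)*(s-1)^2*(s^2+7*s+16)*(s^2+7*s+1)*(s^4+8*s^3+28*s^2+36*s-10) + (-1/3)*(5*s^7+85*s^6+555*s^5+1715*s^4+2590*s^3+1902*s^2+1574*s+322) * U) :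
    f * (s*(s+1)^4*(s+5)^2*(s+2)^2*(s^4+8*s^3+60*s^2+176*s-2)^2) = (1/36)*(s-1)^2*(s^2+7*s+16)*(s^2+7*s+1)*(s^14+28*s^13+326*s^12+1976*s^11+6097*s^10+6152*s^9-6384*s^8+54288*s^7+464976*s^6+1354352*s^5+2119016*s^4+1825888*s^3+658612*s^2+126560*s+1600) + (1/18)*(s-1)^2*(s^2+7*s+16)*(s^2+7*s+1)*(5*s^11+125*s^10+1375*s^9+8715*s^8+34860*s^7+89772*s^6+145500*s^5+142260*s^4+89220*s^3+46660*s^2-4148*s-3220) * U := by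
  have h := rep_uu q s U u hq hU h0 h1 h2 h5 hO hm1 hX2 hX3 hx hx
  linear_combination (1/4)*h + (s*(s+1)^4*(s+5)^2*(s+2)^2*(s^4+8*s^3+60*s^2+176*s-2)^2)/4*hf

lemma rep_z (q s U u w p : ℂ) (hq : q^2 = s) (hU : U^2 = -(s*(s+1)*(s+5)*(s-4)))
    (h0 : s ≠ 0) (h1 : s+1 ≠ 0) (h2 : s+2 ≠ 0) (h5 : s+5 ≠ 0) (hO : s^4+8*s^3+60*s^2+176*s-2 ≠ 0) (hm1 : s-1 ≠ 0) (hX2 : s^2+7*s+16 ≠ 0) (hX3 : s^2+7*s+1 ≠ 0)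
    (hu : u * q * ((s+1)^2*(s+5)*(s+2)*(s^4+8*s^3+60*s^2+176*s-2)) = (-1/3)*(s-1)^2*(s^2+7*s+16)*(s^2+7*s+1)*(s^4+8*s^3+28*s^2+36*s-10) + (-1/3)*(5*s^7+85*s^6+555*s^5+1715*s^4+2590*s^3+1902*s^2+1574*s+322) * U)
    (hw : w * q * (s*(s+1)^3*(s+5)^2*(s+2)*(s^4+8*s^3+60*s^2+176*s-2)) = (-1/6)*s*(s+1)*(s+5)*(s-1)^2*(s^2+7*s+16)*(s^2+7*s+1)*(s^4+8*s^3+28*s^2+36*s-10) + (1/108)*(s-4)*(s-1)^2*(s^2+7*s+16)*(s^2+7*s+1)*(s^5+19*s^4+124*s^3+332*s^2+278*s+2) * U)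
    (hp : p * q * ((s-1)^3*(s^2+7*s+16)^2*(s^2+7*s+1)) = (-6/5)*s*(s+1)^2*(s+5)*(s^4+8*s^3+36*s^2+71*s-8) + (18/5)*s*(s+1)^2*(s+5)^2 * U) :
    (2*((u*u-1)/4)*w*p - 1/2*u*w + 2/3*((u*u-1)/4)) * (s^2*(s+1)^5*(s+5)^3*(s+2)^2*(s^4+8*s^3+60*s^2+176*s-2)^2) = (-1/3240)*s^2*(s+1)*(s+5)*(s-1)^2*(s^2+7*s+16)*(s^2+7*s+1)*(5*s^13+140*s^12+2940*s^11+42130*s^10+361375*s^9+1836522*s^8+5317536*s^7+6523716*s^6-9104328*s^5-51086360*s^4-89547248*s^3-73000464*s^2-24760564*s-4670968) + (1/3240)*(s-1)^2*(s^2+7*s+16)*(s^2+7*s+1)*(3*s^16+105*s^15+1959*s^14+25008*s^13+228665*s^12+1504881*s^11+7167321*s^10+24892486*s^9+63311724*s^8+116979756*s^7+150077688*s^6+114396096*s^5+24226572*s^4-21388004*s^3-4431564*s^2-824760*s+3200) * U := by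
  have hf := rep_f q s U u ((u*u-1)/4) hq hU h0 h1 h2 h5 hO hm1 hX2 hX3 (by ring) hu
  have hh := rep_h q s U _ p hq hU h0 h1 h2 h5 hO hm1 hX2 hX3 hf hp
  have huw := rep_uw q s U u w hq hU h0 h1 h2 h5 hO hm1 hX2 hX3 hu hw
  have hhw := rep_hw q s U _ w hq hU h0 h1 h2 h5 hO hm1 hX2 hX3 hh hw
  linear_combination 2*hhw - 1/2*huw + 2/3*(s*(s+1)*(s+5))*hf

lemma rep_pd (q s U u w p : ℂ) (hq : q^2 = s) (hU : U^2 = -(s*(s+1)*(s+5)*(s-4)))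
    (h0 : s ≠ 0) (h1 : s+1 ≠ 0) (h2 : s+2 ≠ 0) (h5 : s+5 ≠ 0) (hO : s^4+8*s^3+60*s^2+176*s-2 ≠ 0) (hm1 : s-1 ≠ 0) (hX2 : s^2+7*s+16 ≠ 0) (hX3 : s^2+7*s+1 ≠ 0)
    (hu : u * q * ((s+1)^2*(s+5)*(s+2)*(s^4+8*s^3+60*s^2+176*s-2)) = (-1/3)*(s-1)^2*(s^2+7*s+16)*(s^2+7*s+1)*(s^4+8*s^3+28*s^2+36*s-10) + (-1/3)*(5*s^7+85*s^6+555*s^5+1715*s^4+2590*s^3+1902*s^2+1574*s+322) * U)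
    (hw : w * q * (s*(s+1)^3*(s+5)^2*(s+2)*(s^4+8*s^3+60*s^2+176*s-2)) = (-1/6)*s*(s+1)*(s+5)*(s-1)^2*(s^2+7*s+16)*(s^2+7*s+1)*(s^4+8*s^3+28*s^2+36*s-10) + (1/108)*(s-4)*(s-1)^2*(s^2+7*s+16)*(s^2+7*s+1)*(s^5+19*s^4+124*s^3+332*s^2+278*s+2) * U)
    (hp : p * q * ((s-1)^3*(s^2+7*s+16)^2*(s^2+7*s+1)) = (-6/5)*s*(s+1)^2*(s+5)*(s^4+8*s^3+36*s^2+71*s-8) + (18/5)*s*(s+1)^2*(s+5)^2 * U) :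
    (-(u*p*(w*p)) - ((u*u-1)/4)*p*p + w*p - 1/6*(u*p) - 4/225) * (s*(s+1)*(s+5)*(s-1)^3*(s^2+7*s+16)^2*(s^2+7*s+1)) = (-1/150)*s*(s+1)*(s+5)^2*(5*s^8+65*s^7+167*s^6-910*s^5-5185*s^4-14035*s^3-22675*s^2-3448*s-640) + (-1/450)*(3*s^11+75*s^10+937*s^9+7677*s^8+42840*s^7+157524*s^6+373365*s^5+559377*s^4+447087*s^3+75795*s^2+15576*s-640) * U := by
  have hf := rep_f q s U u ((u*u-1)/4) hq hU h0 h1 h2 h5 hO hm1 hX2 hX3 (by ring) hu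
  have hh := rep_h q s U _ p hq hU h0 h1 h2 h5 hO hm1 hX2 hX3 hf hp
  have hg := rep_g q s U w p hq hU h0 h1 h2 h5 hO hm1 hX2 hX3 hw hp
  have hm := rep_m q s U u p hq hU h0 h1 h2 h5 hO hm1 hX2 hX3 hu hp
  have hmg := rep_mg q s U _ _ hq hU h0 h1 h2 h5 hO hm1 hX2 hX3 hm hg
  have hhp := rep_hp q s U _ p hq hU h0 h1 h2 h5 hO hm1 hX2 hX3 hh hp
  linear_combination -hmg - (s*(s+1)*(s+5))*hhp + ((s-1)^3*(s^2+7*s+16)^2*(s^2+7*s+1))*hg - 1/6*(s*(s+1)*(s+5))*hm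

noncomputable def yA (q : ℂ) : ℂ := (-1)*q^20 + (-20)*q^18 + (-163)*q^16 + (-685)*q^14 + (-1366)*q^12 + (-151)*q^10 + (4010)*q^8 + (3062)*q^6 + (-5140)*q^4 + (294)*q^2 + (160)
noncomputable def yA' (q : ℂ) : ℂ := (-20)*q^19 + (-360)*q^17 + (-2608)*q^15 + (-9590)*q^13 + (-16392)*q^11 + (-1510)*q^9 + (32080)*q^7 + (18372)*q^5 + (-20560)*q^3 + (588)*q^1
lemma hd_yA (q : ℂ) : HasDerivAt yA (yA' q) q := by
  have h := ((((((((((((hasDerivAt_pow 20 q).const_mul (-1:ℂ)).fun_add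
    ((hasDerivAt_pow 18 q).const_mul (-20:ℂ))).fun_add
    ((hasDerivAt_pow 16 q).const_mul (-163:ℂ))).fun_add
    ((hasDerivAt_pow 14 q).const_mul (-685:ℂ))).fun_add
    ((hasDerivAt_pow 12 q).const_mul (-1366:ℂ))).fun_add
    ((hasDerivAt_pow 10 q).const_mul (-151:ℂ))).fun_add
    ((hasDerivAt_pow 8 q).const_mul (4010:ℂ))).fun_add
    ((hasDerivAt_pow 6 q).const_mul (3062:ℂ))).fun_add
    ((hasDerivAt_pow 4 q).const_mul (-5140:ℂ))).fun_add
    ((hasDerivAt_pow 2 q).const_mul (294:ℂ))).fun_add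
    (hasDerivAt_const q (160:ℂ)))
  refine HasDerivAt.congr_deriv (f := yA) h ?_
  simp only [yA']
  norm_num
  try ring

noncomputable def yB (q : ℂ) : ℂ := (-5)*q^15 + (-85)*q^13 + (-555)*q^11 + (-1715)*q^9 + (-2590)*q^7 + (-1902)*q^5 + (-1574)*q^3 + (-322)*q^1
noncomputable def yB' (q : ℂ) : ℂ := (-75)*q^14 + (-1105)*q^12 + (-6105)*q^10 + (-15435)*q^8 + (-18130)*q^6 + (-9510)*q^4 + (-4722)*q^2 + (-322)
lemma hd_yB (q : ℂ) : HasDerivAt yB (yB' q) q := by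
  have h := (((((((((hasDerivAt_pow 15 q).const_mul (-5:ℂ)).fun_add
    ((hasDerivAt_pow 13 q).const_mul (-85:ℂ))).fun_add
    ((hasDerivAt_pow 11 q).const_mul (-555:ℂ))).fun_add
    ((hasDerivAt_pow 9 q).const_mul (-1715:ℂ))).fun_add
    ((hasDerivAt_pow 7 q).const_mul (-2590:ℂ))).fun_add
    ((hasDerivAt_pow 5 q).const_mul (-1902:ℂ))).fun_add
    ((hasDerivAt_pow 3 q).const_mul (-1574:ℂ))).fun_add
    ((hasDerivAt_pow 1 q).const_mul (-322:ℂ)))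
  refine HasDerivAt.congr_deriv (f := yB) h ?_
  simp only [yB']
  norm_num
  try ring

noncomputable def yC (q : ℂ) : ℂ := (6)*q^17 + (102)*q^15 + (942)*q^13 + (5658)*q^11 + (19848)*q^9 + (36492)*q^7 + (31812)*q^5 + (10236)*q^3 + (-120)*q^1
noncomputable def yC' (q : ℂ) : ℂ := (102)*q^16 + (1530)*q^14 + (12246)*q^12 + (62238)*q^10 + (178632)*q^8 + (255444)*q^6 + (159060)*q^4 + (30708)*q^2 + (-120)
lemma hd_yC (q : ℂ) : HasDerivAt yC (yC' q) q := by
  have h := ((((((((((hasDerivAt_pow 17 q).const_mul (6:ℂ)).fun_add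
    ((hasDerivAt_pow 15 q).const_mul (102:ℂ))).fun_add
    ((hasDerivAt_pow 13 q).const_mul (942:ℂ))).fun_add
    ((hasDerivAt_pow 11 q).const_mul (5658:ℂ))).fun_add
    ((hasDerivAt_pow 9 q).const_mul (19848:ℂ))).fun_add
    ((hasDerivAt_pow 7 q).const_mul (36492:ℂ))).fun_add
    ((hasDerivAt_pow 5 q).const_mul (31812:ℂ))).fun_add
    ((hasDerivAt_pow 3 q).const_mul (10236:ℂ))).fun_add
    ((hasDerivAt_pow 1 q).const_mul (-120:ℂ)))
  refine HasDerivAt.congr_deriv (f := yC) h ?_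
  simp only [yC']
  norm_num
  try ring

noncomputable def tB (q : ℂ) : ℂ := (-1)*q^14 + (-17)*q^12 + (-111)*q^10 + (-370)*q^8 + (-815)*q^6 + (-1077)*q^4 + (-169)*q^2 + (-32)
noncomputable def tB' (q : ℂ) : ℂ := (-14)*q^13 + (-204)*q^11 + (-1110)*q^9 + (-2960)*q^7 + (-4890)*q^5 + (-4308)*q^3 + (-338)*q^1
lemma hd_tB (q : ℂ) : HasDerivAt tB (tB' q) q := by
  have h := (((((((((hasDerivAt_pow 14 q).const_mul (-1:ℂ)).fun_add
    ((hasDerivAt_pow 12 q).const_mul (-17:ℂ))).fun_add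
    ((hasDerivAt_pow 10 q).const_mul (-111:ℂ))).fun_add
    ((hasDerivAt_pow 8 q).const_mul (-370:ℂ))).fun_add
    ((hasDerivAt_pow 6 q).const_mul (-815:ℂ))).fun_add
    ((hasDerivAt_pow 4 q).const_mul (-1077:ℂ))).fun_add
    ((hasDerivAt_pow 2 q).const_mul (-169:ℂ))).fun_add
    (hasDerivAt_const q (-32:ℂ)))
  refine HasDerivAt.congr_deriv (f := tB) h ?_
  simp only [tB']
  norm_num
  try ring

noncomputable def tC (q : ℂ) : ℂ := (108)*q^12 + (1404)*q^10 + (6264)*q^8 + (11448)*q^6 + (9180)*q^4 + (2700)*q^2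
noncomputable def tC' (q : ℂ) : ℂ := (1296)*q^11 + (14040)*q^9 + (50112)*q^7 + (68688)*q^5 + (36720)*q^3 + (5400)*q^1
lemma hd_tC (q : ℂ) : HasDerivAt tC (tC' q) q := by
  have h := (((((((hasDerivAt_pow 12 q).const_mul (108:ℂ)).fun_add
    ((hasDerivAt_pow 10 q).const_mul (1404:ℂ))).fun_add
    ((hasDerivAt_pow 8 q).const_mul (6264:ℂ))).fun_add
    ((hasDerivAt_pow 6 q).const_mul (11448:ℂ))).fun_add
    ((hasDerivAt_pow 4 q).const_mul (9180:ℂ))).fun_add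
    ((hasDerivAt_pow 2 q).const_mul (2700:ℂ)))
  refine HasDerivAt.congr_deriv (f := tC) h ?_
  simp only [tC']
  norm_num
  try ring

noncomputable def pA (q : ℂ) : ℂ := (-6)*q^16 + (-90)*q^14 + (-618)*q^12 + (-2496)*q^10 + (-5550)*q^8 + (-5430)*q^6 + (-1602)*q^4 + (240)*q^2
noncomputable def pA' (q : ℂ) : ℂ := (-96)*q^15 + (-1260)*q^13 + (-7416)*q^11 + (-24960)*q^9 + (-44400)*q^7 + (-32580)*q^5 + (-6408)*q^3 + (480)*q^1
lemma hd_pA (q : ℂ) : HasDerivAt pA (pA' q) q := by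
  have h := (((((((((hasDerivAt_pow 16 q).const_mul (-6:ℂ)).fun_add
    ((hasDerivAt_pow 14 q).const_mul (-90:ℂ))).fun_add
    ((hasDerivAt_pow 12 q).const_mul (-618:ℂ))).fun_add
    ((hasDerivAt_pow 10 q).const_mul (-2496:ℂ))).fun_add
    ((hasDerivAt_pow 8 q).const_mul (-5550:ℂ))).fun_add
    ((hasDerivAt_pow 6 q).const_mul (-5430:ℂ))).fun_add
    ((hasDerivAt_pow 4 q).const_mul (-1602:ℂ))).fun_add
    ((hasDerivAt_pow 2 q).const_mul (240:ℂ)))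
  refine HasDerivAt.congr_deriv (f := pA) h ?_
  simp only [pA']
  norm_num
  try ring

noncomputable def pB (q : ℂ) : ℂ := (18)*q^11 + (216)*q^9 + (828)*q^7 + (1080)*q^5 + (450)*q^3
noncomputable def pB' (q : ℂ) : ℂ := (198)*q^10 + (1944)*q^8 + (5796)*q^6 + (5400)*q^4 + (1350)*q^2
lemma hd_pB (q : ℂ) : HasDerivAt pB (pB' q) q := by
  have h := ((((((hasDerivAt_pow 11 q).const_mul (18:ℂ)).fun_add
    ((hasDerivAt_pow 9 q).const_mul (216:ℂ))).fun_add
    ((hasDerivAt_pow 7 q).const_mul (828:ℂ))).fun_add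
    ((hasDerivAt_pow 5 q).const_mul (1080:ℂ))).fun_add
    ((hasDerivAt_pow 3 q).const_mul (450:ℂ)))
  refine HasDerivAt.congr_deriv (f := pB) h ?_
  simp only [pB']
  norm_num
  try ring

noncomputable def pC (q : ℂ) : ℂ := (5)*q^19 + (90)*q^17 + (600)*q^15 + (1635)*q^13 + (45)*q^11 + (-7320)*q^9 + (-4410)*q^7 + (16875)*q^5 + (-6240)*q^3 + (-1280)*q^1
noncomputable def pC' (q : ℂ) : ℂ := (95)*q^18 + (1530)*q^16 + (9000)*q^14 + (21255)*q^12 + (495)*q^10 + (-65880)*q^8 + (-30870)*q^6 + (84375)*q^4 + (-18720)*q^2 + (-1280)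
lemma hd_pC (q : ℂ) : HasDerivAt pC (pC' q) q := by
  have h := (((((((((((hasDerivAt_pow 19 q).const_mul (5:ℂ)).fun_add
    ((hasDerivAt_pow 17 q).const_mul (90:ℂ))).fun_add
    ((hasDerivAt_pow 15 q).const_mul (600:ℂ))).fun_add
    ((hasDerivAt_pow 13 q).const_mul (1635:ℂ))).fun_add
    ((hasDerivAt_pow 11 q).const_mul (45:ℂ))).fun_add
    ((hasDerivAt_pow 9 q).const_mul (-7320:ℂ))).fun_add
    ((hasDerivAt_pow 7 q).const_mul (-4410:ℂ))).fun_add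
    ((hasDerivAt_pow 5 q).const_mul (16875:ℂ))).fun_add
    ((hasDerivAt_pow 3 q).const_mul (-6240:ℂ))).fun_add
    ((hasDerivAt_pow 1 q).const_mul (-1280:ℂ)))
  refine HasDerivAt.congr_deriv (f := pC) h ?_
  simp only [pC']
  norm_num
  try ring

noncomputable def tF (v : ℂ → ℂ) (q : ℂ) : ℂ := 1/2 + (0 + tB q * v q) / tC q
noncomputable def yF (v : ℂ → ℂ) (q : ℂ) : ℂ := 1/2 + (yA q + yB q * v q) / yC q
noncomputable def pF (v : ℂ → ℂ) (q : ℂ) : ℂ := (pA q + pB q * v q) / pC q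
noncomputable def sig (v : ℂ → ℂ) (q : ℂ) : ℂ := 540*q*(q^2+1)*v q/((q^2-4)*(q^2-1)*(q^4+7*q^2+16)*(q^4+7*q^2+1))

lemma hd_rep {a b c v : ℂ → ℂ} {a' b' c' v' q F F' : ℂ} (ha : HasDerivAt a a' q)
    (hb : HasDerivAt b b' q) (hc : HasDerivAt c c' q) (hv : HasDerivAt v v' q) (hc0 : c q ≠ 0)
    (hv2 : 2*F*v' = F' * v q) :
    ∃ d, HasDerivAt (fun x => (a x + b x * v x) / c x) d q ∧
      d * ((c q)^2*(2*F)) = (a' * c q - a q * c')*(2*F)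
        + (2*F*(b'*c q - b q * c') + b q * c q * F') * v q := by
  refine ⟨_, (ha.fun_add (hb.fun_mul hv)).fun_div hc hc0, ?_⟩
  field_simp
  linear_combination (b q * c q) * hv2

lemma eq_rep {d e v A B C A2 B2 C2 : ℂ} (h : d * C = A + B * v) (h' : e * C2 = A2 + B2 * v)
    (hC : C ≠ 0) (hC2 : C2 ≠ 0) (hA : A * C2 = A2 * C) (hB : B * C2 = B2 * C) : d = e := by
  apply mul_right_cancel₀ (mul_ne_zero hC hC2)
  linear_combination C2 * h - C * h' + hA + v * hB

lemma rep_sig (v : ℂ → ℂ) (q e a b c : ℂ) (hsq : (v q)^2 = -((q^2+1)*(q^2+5)*(q^2-4)))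
    (h4 : q^2-4 ≠ 0) (hm1 : q^2-1 ≠ 0) (hX2 : q^4+7*q^2+16 ≠ 0) (hX3 : q^4+7*q^2+1 ≠ 0)
    (he : e * c = a + b * (q * v q)) :
    (sig v q * e) * (c * ((q^2-4)*(q^2-1)*(q^4+7*q^2+16)*(q^4+7*q^2+1))) =
      540*q*(q^2+1)*(b*q*(-((q^2+1)*(q^2+5)*(q^2-4)))) + (540*q*(q^2+1)*a) * v q := by
  have hs : sig v q * ((q^2-4)*(q^2-1)*(q^4+7*q^2+16)*(q^4+7*q^2+1)) = 540*q*(q^2+1)*v q := by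
    unfold sig
    rw [div_mul_cancel₀]
    simp [h4, hm1, hX2, hX3]
  linear_combination (e*c)*hs + (540*q*(q^2+1)*v q)*he + (540*q*(q^2+1)*b*q)*hsq

lemma tC_eq (q : ℂ) : tC q = 108*q^2*(q^2+1)^3*(q^2+5)^2 := by
  unfold tC; ring
lemma yC_eq (q : ℂ) : yC q = 6*q*(q^2+1)^2*(q^2+2)*(q^2+5)*(q^8+8*q^6+60*q^4+176*q^2-2) := by
  unfold yC; ring
lemma pC_eq (q : ℂ) : pC q = 5*q*(q^2-1)^3*(q^4+7*q^2+16)^2*(q^4+7*q^2+1) := by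
  unfold pC; ring

lemma tF_mul (v : ℂ → ℂ) (q : ℂ) (h : tC q ≠ 0) : (tF v q - 1/2) * tC q = tB q * v q := by
  unfold tF; field_simp; ring
lemma yF_mul (v : ℂ → ℂ) (q : ℂ) (h : yC q ≠ 0) :
    (yF v q - 1/2) * yC q = yA q + yB q * v q := by
  unfold yF; field_simp; ring
lemma pF_mul (v : ℂ → ℂ) (q : ℂ) (h : pC q ≠ 0) : pF v q * pC q = pA q + pB q * v q := by
  unfold pF; field_simp

lemma tF_tt (v : ℂ → ℂ) (q : ℂ) (hsq : (v q)^2 = -((q^2+1)*(q^2+5)*(q^2-4)))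
    (hq0 : q ≠ 0) (h1 : q^2+1 ≠ 0) (h5 : q^2+5 ≠ 0) :
    tF v q * (tF v q - 1) * (11664*q^4*(q^2+1)^5*(q^2+5)^3) = -((q^2-1)^5*(q^4+7*q^2+16)^3*(q^4+7*q^2+1)^2) + 0 * (q * v q) := by
  have hC : tC q ≠ 0 := by rw [tC_eq]; simp [hq0, h1, h5]
  have h := tF_mul v q hC
  rw [tC_eq] at h
  simp only [tB] at h
  have hh : (tF v q * (tF v q - 1) * (11664*q^4*(q^2+1)^5*(q^2+5)^3)) * ((q^2+1)*(q^2+5)) =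
      (-((q^2-1)^5*(q^4+7*q^2+16)^3*(q^4+7*q^2+1)^2)) * ((q^2+1)*(q^2+5)) := by
    have e1 : (tF v q * (tF v q - 1) * (11664*q^4*(q^2+1)^5*(q^2+5)^3)) * ((q^2+1)*(q^2+5)) =
      ((tF v q - 1/2) * (108*q^2*(q^2+1)^3*(q^2+5)^2))^2 - 1/4*(108*q^2*(q^2+1)^3*(q^2+5)^2)^2 := by
      ring
    rw [e1, h, mul_pow, hsq]
    ring
  have := mul_right_cancel₀ (mul_ne_zero h1 h5) hh
  rw [this]; ring

lemma u_rep (v : ℂ → ℂ) (q : ℂ) (hq0 : q ≠ 0) (h1 : q^2+1 ≠ 0) (h2 : q^2+2 ≠ 0) (h5 : q^2+5 ≠ 0) (hO : q^8+8*q^6+60*q^4+176*q^2-2 ≠ 0) :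
    (2 * yF v q - 1) * q * ((q^2+1)^2*(q^2+5)*(q^2+2)*(q^8+8*q^6+60*q^4+176*q^2-2)) = (-1/3)*(q^2-1)^2*(q^4+7*q^2+16)*(q^4+7*q^2+1)*(q^8+8*q^6+28*q^4+36*q^2-10) + (-1/3)*(5*q^14+85*q^12+555*q^10+1715*q^8+2590*q^6+1902*q^4+1574*q^2+322) * (q * v q) := by
  have hC : yC q ≠ 0 := by rw [yC_eq]; simp [hq0, h1, h2, h5, hO]
  have h := yF_mul v q hC
  rw [yC_eq] at h
  simp only [yA, yB] at h
  linear_combination (1/3) * h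

lemma w_rep (v : ℂ → ℂ) (q : ℂ) (hq0 : q ≠ 0) (h1 : q^2+1 ≠ 0) (h2 : q^2+2 ≠ 0) (h5 : q^2+5 ≠ 0) (hO : q^8+8*q^6+60*q^4+176*q^2-2 ≠ 0) :
    (yF v q - tF v q) * q * (q^2*(q^2+1)^3*(q^2+5)^2*(q^2+2)*(q^8+8*q^6+60*q^4+176*q^2-2)) = (-1/6)*q^2*(q^2+1)*(q^2+5)*(q^2-1)^2*(q^4+7*q^2+16)*(q^4+7*q^2+1)*(q^8+8*q^6+28*q^4+36*q^2-10) + (1/108)*(q^2-4)*(q^2-1)^2*(q^4+7*q^2+16)*(q^4+7*q^2+1)*(q^10+19*q^8+124*q^6+332*q^4+278*q^2+2) * (q * v q) := by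
  have hC : yC q ≠ 0 := by rw [yC_eq]; simp [hq0, h1, h2, h5, hO]
  have h := yF_mul v q hC
  rw [yC_eq] at h
  simp only [yA, yB] at h
  have hC' : tC q ≠ 0 := by rw [tC_eq]; simp [hq0, h1, h5]
  have h' := tF_mul v q hC'
  rw [tC_eq] at h'
  simp only [tB] at h'
  linear_combination (1/6*q^2*(q^2+1)*(q^2+5)) * h - (1/108*q*(q^2+2)*(q^8+8*q^6+60*q^4+176*q^2-2)) * h'

lemma p_rep (v : ℂ → ℂ) (q : ℂ) (hq0 : q ≠ 0)
    (hm1 : q^2-1 ≠ 0) (hX2 : q^4+7*q^2+16 ≠ 0) (hX3 : q^4+7*q^2+1 ≠ 0) :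
    pF v q * q * ((q^2-1)^3*(q^4+7*q^2+16)^2*(q^4+7*q^2+1)) = (-6/5)*q^2*(q^2+1)^2*(q^2+5)*(q^8+8*q^6+36*q^4+71*q^2-8) + (18/5)*q^2*(q^2+1)^2*(q^2+5)^2 * (q * v q) := by
  have hC : pC q ≠ 0 := by rw [pC_eq]; simp [hq0, hm1, hX2, hX3]
  have h := pF_mul v q hC
  rw [pC_eq] at h
  simp only [pA, pB] at h
  linear_combination (1/5) * h

lemma two_F (v : ℂ → ℂ) (q v' : ℂ) (hsq : (v q)^2 = -((q^2+1)*(q^2+5)*(q^2-4)))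
    (h2v : 2 * v q * v' = (-(6*q^5+8*q^3-38*q))) : 2*(-((q^2+1)*(q^2+5)*(q^2-4)))*v' = (-(6*q^5+8*q^3-38*q)) * v q := by
  linear_combination v q * h2v - 2*v'*hsq

lemma hd_t (v : ℂ → ℂ) (q v' : ℂ) (hv : HasDerivAt v v' q)
    (hsq : (v q)^2 = -((q^2+1)*(q^2+5)*(q^2-4))) (h2v : 2 * v q * v' = (-(6*q^5+8*q^3-38*q)))
    (hq0 : q ≠ 0) (h1 : q^2+1 ≠ 0) (h5 : q^2+5 ≠ 0)
    (hm1 : q^2-1 ≠ 0) (hX2 : q^4+7*q^2+16 ≠ 0) (hX3 : q^4+7*q^2+1 ≠ 0) (h4 : q^2-4 ≠ 0) :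
    HasDerivAt (tF v) (sig v q * (tF v q * (tF v q - 1))) q := by
  have hC : tC q ≠ 0 := by rw [tC_eq]; simp [hq0, h1, h5]
  obtain ⟨d, hd, hd2⟩ := hd_rep (hasDerivAt_const q (0:ℂ)) (hd_tB q) (hd_tC q) hv hC
    (two_F v q v' hsq h2v)
  replace hd : HasDerivAt (tF v) d q := hd.const_add (1/2)
  have he := tF_tt v q hsq hq0 h1 h5
  generalize tF v q * (tF v q - 1) = e at he ⊢
  refine hd.congr_deriv (eq_rep hd2 (e := sig v q * e) (rep_sig v q e _ _ _ hsq h4 hm1 hX2 hX3 he) ?_ ?_ ?_ ?_)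
  · simp [hC, h1, h5, h4]
  · simp [hq0, h1, h5, h4, hm1, hX2, hX3]
  · simp only [tB, tC, tB', tC']
    ring
  · simp only [tB, tC, tB', tC']
    ring

lemma hd_y (v : ℂ → ℂ) (q v' : ℂ) (hv : HasDerivAt v v' q)
    (hsq : (v q)^2 = -((q^2+1)*(q^2+5)*(q^2-4))) (h2v : 2 * v q * v' = (-(6*q^5+8*q^3-38*q)))
    (hq0 : q ≠ 0) (h1 : q^2+1 ≠ 0) (h2 : q^2+2 ≠ 0) (h5 : q^2+5 ≠ 0) (hO : q^8+8*q^6+60*q^4+176*q^2-2 ≠ 0)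
    (hm1 : q^2-1 ≠ 0) (hX2 : q^4+7*q^2+16 ≠ 0) (hX3 : q^4+7*q^2+1 ≠ 0) (h4 : q^2-4 ≠ 0) :
    HasDerivAt (yF v) (sig v q * (2*(yF v q * (yF v q - 1))*(yF v q - tF v q)*pF v q - 1/2*(2*yF v q - 1)*(yF v q - tF v q) + 2/3*(yF v q * (yF v q - 1)))) q := by
  have hC : yC q ≠ 0 := by rw [yC_eq]; simp [hq0, h1, h2, h5, hO]
  obtain ⟨d, hd, hd2⟩ := hd_rep (hd_yA q) (hd_yB q) (hd_yC q) hv hC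
    (two_F v q v' hsq h2v)
  replace hd : HasDerivAt (yF v) d q := hd.const_add (1/2)
  have hU : (q * v q)^2 = -(q^2*(q^2+1)*(q^2+5)*(q^2-4)) := by rw [mul_pow, hsq]; ring
  have hu := u_rep v q hq0 h1 h2 h5 hO
  have hw := w_rep v q hq0 h1 h2 h5 hO
  have hp := p_rep v q hq0 hm1 hX2 hX3
  have he : (2*(yF v q * (yF v q - 1))*(yF v q - tF v q)*pF v q - 1/2*(2*yF v q - 1)*(yF v q - tF v q) + 2/3*(yF v q * (yF v q - 1))) * (q^4*(q^2+1)^5*(q^2+5)^3*(q^2+2)^2*(q^8+8*q^6+60*q^4+176*q^2-2)^2) = (-1/3240)*q^4*(q^2+1)*(q^2+5)*(q^2-1)^2*(q^4+7*q^2+16)*(q^4+7*q^2+1)*(5*q^26+140*q^24+2940*q^22+42130*q^20+361375*q^18+1836522*q^16+5317536*q^14+6523716*q^12-9104328*q^10-51086360*q^8-89547248*q^6-73000464*q^4-24760564*q^2-4670968) + (1/3240)*(q^2-1)^2*(q^4+7*q^2+16)*(q^4+7*q^2+1)*(3*q^32+105*q^30+1959*q^28+25008*q^26+228665*q^24+1504881*q^22+7167321*q^20+24892486*q^18+63311724*q^16+116979756*q^14+150077688*q^12+114396096*q^10+24226572*q^8-21388004*q^6-4431564*q^4-824760*q^2+3200)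 * (q * v q) := by
    have hz := rep_z q (q^2) (q * v q) (2 * yF v q - 1) (yF v q - tF v q) (pF v q) rfl hU
      (pow_ne_zero 2 hq0) h1 h2 h5 (by convert hO using 1; ring) hm1 (by convert hX2 using 1; ring) (by convert hX3 using 1; ring)
      (by linear_combination hu) (by linear_combination hw) (by linear_combination hp)
    linear_combination hz
  generalize (2*(yF v q * (yF v q - 1))*(yF v q - tF v q)*pF v q - 1/2*(2*yF v q - 1)*(yF v q - tF v q) + 2/3*(yF v q * (yF v q - 1))) = e at he ⊢
  refine hd.congr_deriv (eq_rep hd2 (e := sig v q * e) (rep_sig v q e _ _ _ hsq h4 hm1 hX2 hX3 he) ?_ ?_ ?_ ?_)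
  · simp [hC, h1, h5, h4]
  · simp [hq0, h1, h2, h5, hO, h4, hm1, hX2, hX3]
  · simp only [yA, yB, yC, yA', yB', yC']
    ring
  · simp only [yA, yB, yC, yA', yB', yC']
    ring

lemma hd_p (v : ℂ → ℂ) (q v' : ℂ) (hv : HasDerivAt v v' q)
    (hsq : (v q)^2 = -((q^2+1)*(q^2+5)*(q^2-4))) (h2v : 2 * v q * v' = (-(6*q^5+8*q^3-38*q)))
    (hq0 : q ≠ 0) (h1 : q^2+1 ≠ 0) (h2 : q^2+2 ≠ 0) (h5 : q^2+5 ≠ 0) (hO : q^8+8*q^6+60*q^4+176*q^2-2 ≠ 0)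
    (hm1 : q^2-1 ≠ 0) (hX2 : q^4+7*q^2+16 ≠ 0) (hX3 : q^4+7*q^2+1 ≠ 0) (h4 : q^2-4 ≠ 0) :
    HasDerivAt (pF v) (sig v q * (-((2*yF v q - 1)*pF v q*((yF v q - tF v q)*pF v q)) - (yF v q * (yF v q - 1))*pF v q*pF v q + (yF v q - tF v q)*pF v q - 1/6*((2*yF v q - 1)*pF v q) - 4/225)) q := by
  have hC : pC q ≠ 0 := by rw [pC_eq]; simp [hq0, hm1, hX2, hX3]
  obtain ⟨d, hd, hd2⟩ := hd_rep (hd_pA q) (hd_pB q) (hd_pC q) hv hC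
    (two_F v q v' hsq h2v)
  replace hd : HasDerivAt (pF v) d q := hd
  have hU : (q * v q)^2 = -(q^2*(q^2+1)*(q^2+5)*(q^2-4)) := by rw [mul_pow, hsq]; ring
  have hu := u_rep v q hq0 h1 h2 h5 hO
  have hw := w_rep v q hq0 h1 h2 h5 hO
  have hp := p_rep v q hq0 hm1 hX2 hX3
  have he : (-((2*yF v q - 1)*pF v q*((yF v q - tF v q)*pF v q)) - (yF v q * (yF v q - 1))*pF v q*pF v q + (yF v q - tF v q)*pF v q - 1/6*((2*yF v q - 1)*pF v q) - 4/225) * (q^2*(q^2+1)*(q^2+5)*(q^2-1)^3*(q^4+7*q^2+16)^2*(q^4+7*q^2+1)) = (-1/150)*q^2*(q^2+1)*(q^2+5)^2*(5*q^16+65*q^14+167*q^12-910*q^10-5185*q^8-14035*q^6-22675*q^4-3448*q^2-640) + (-1/450)*(3*q^22+75*q^20+937*q^18+7677*q^16+42840*q^14+157524*q^12+373365*q^10+559377*q^8+447087*q^6+75795*q^4+15576*q^2-640) * (q * v q) := by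
    have hz := rep_pd q (q^2) (q * v q) (2 * yF v q - 1) (yF v q - tF v q) (pF v q) rfl hU
      (pow_ne_zero 2 hq0) h1 h2 h5 (by convert hO using 1; ring) hm1 (by convert hX2 using 1; ring) (by convert hX3 using 1; ring)
      (by linear_combination hu) (by linear_combination hw) (by linear_combination hp)
    linear_combination hz
  generalize (-((2*yF v q - 1)*pF v q*((yF v q - tF v q)*pF v q)) - (yF v q * (yF v q - 1))*pF v q*pF v q + (yF v q - tF v q)*pF v q - 1/6*((2*yF v q - 1)*pF v q) - 4/225) = e at he ⊢
  refine hd.congr_deriv (eq_rep hd2 (e := sig v q * e) (rep_sig v q e _ _ _ hsq h4 hm1 hX2 hX3 he) ?_ ?_ ?_ ?_)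
  · simp [hC, h1, h5, h4]
  · simp [hq0, h1, h2, h5, hO, h4, hm1, hX2, hX3]
  · simp only [pA, pB, pC, pA', pB', pC']
    ring
  · simp only [pA, pB, pC, pA', pB', pC']
    ring

lemma pvi_alg (t y p D1 D2 : ℂ) (ht0 : t ≠ 0) (ht1 : t - 1 ≠ 0) (hy0 : y ≠ 0) (hy1 : y - 1 ≠ 0)
    (hyt : y - t ≠ 0) (Z W : ℂ)
    (hZ : Z = 2*(y*(y-1))*(y-t)*p - 1/2*(2*y-1)*(y-t) + 2/3*(y*(y-1)))
    (hW : W = -((2*y-1)*p*((y-t)*p)) - (y*(y-1))*p*p + (y-t)*p - 1/6*((2*y-1)*p) - 4/225)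
    (h1 : D1 * (t*(t-1)) = Z)
    (h2 : D2 * (t*(t-1)) * (t*(t-1)) + D1 * ((t*(t-1))*(2*t-1)) =
      2*(Z*(2*y-1))*(y-t)*p + 2*(y*(y-1))*(Z - t*(t-1))*p + 2*(y*(y-1))*(y-t)*W
       - Z*(y-t) - 1/2*(2*y-1)*(Z-t*(t-1)) + 2/3*(Z*(2*y-1))) :
    D2 = (1/2) * (1/y + 1/(y - 1) + 1/(y - t)) * D1^2
    - (1/t + 1/(t-1) + 1/(y - t)) * D1
    + (y * (y - 1) * (y - t) / (t^2 * (t-1)^2)) *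
      (((4/5:ℂ) - 1)^2/2 + (-((1/2:ℂ)^2/2)) * t/y^2 + ((1/2:ℂ)^2/2) * (t-1)/(y - 1)^2
        + ((1 - (1/3:ℂ)^2)/2) * (t*(t-1))/(y - t)^2) := by
  have hD1 : D1 = Z / (t*(t-1)) := by field_simp; linear_combination h1
  have hD2 : D2 = (2*(Z*(2*y-1))*(y-t)*p + 2*(y*(y-1))*(Z - t*(t-1))*p + 2*(y*(y-1))*(y-t)*W
       - Z*(y-t) - 1/2*(2*y-1)*(Z-t*(t-1)) + 2/3*(Z*(2*y-1)) - Z*(2*t-1)) / ((t*(t-1))*(t*(t-1))) := by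
    rw [eq_div_iff (by simp [ht0, ht1])]
    linear_combination h2 - (2*t-1)*h1
  rw [hD2, hD1, hZ, hW]
  field_simp
  ring

lemma pvi_local (t y p Y : ℂ → ℂ) (q σ : ℂ) (hσ : σ ≠ 0)
    (ht0 : t q ≠ 0) (ht1 : t q ≠ 1) (hy0 : y q ≠ 0) (hy1 : y q ≠ 1) (hyt : y q ≠ t q)
    (hY : Y (t q) = y q)
    (hdt : HasDerivAt t (σ * (t q * (t q - 1))) q)
    (hdy : HasDerivAt y (σ * (2*(y q*(y q-1))*(y q-t q)*p q - 1/2*(2*y q-1)*(y q-t q)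
      + 2/3*(y q*(y q-1)))) q)
    (hdp : HasDerivAt p (σ * (-((2*y q-1)*p q*((y q-t q)*p q)) - (y q*(y q-1))*p q*p q
      + (y q-t q)*p q - 1/6*((2*y q-1)*p q) - 4/225)) q)
    (hYd : DifferentiableAt ℂ (deriv Y) (t q))
    (hev : ∀ᶠ x in nhds q, deriv Y (t x) * (t x * (t x - 1)) =
      2*(y x*(y x-1))*(y x-t x)*p x - 1/2*(2*y x-1)*(y x-t x) + 2/3*(y x*(y x-1))) :
    PVIAt (1/2) (1/2) (1/3) (4/5) Y (t q) := by
  unfold PVIAt pviRHS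
  rw [hY]
  have hc : HasDerivAt (fun x => deriv Y (t x)) _ q := hYd.hasDerivAt.comp q hdt
  have hL := hc.fun_mul (hdt.fun_mul (hdt.sub_const 1))
  have hyy := hdy.fun_mul (hdy.sub_const 1)
  have hw := hdy.fun_sub hdt
  have hu := (hdy.const_mul (2:ℂ)).sub_const 1
  have hR := (((((hyy.const_mul (2:ℂ)).fun_mul hw).fun_mul hdp).fun_sub
    ((hu.const_mul (1/2:ℂ)).fun_mul hw)).fun_add (hyy.const_mul (2/3:ℂ)))
  have hE := (hL.congr_of_eventuallyEq (hev.mono fun x hx => hx.symm)).unique hR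
  refine pvi_alg (t q) (y q) (p q) _ _ ht0 (sub_ne_zero.2 ht1) hy0 (sub_ne_zero.2 hy1)
    (sub_ne_zero.2 hyt) _ _ rfl rfl hev.self_of_nhds ?_
  apply mul_left_cancel₀ hσ
  linear_combination hE

/-- The icosahedral algebraic Painlevé VI solution of Boalch type 47:
`y₄₇(t₄₇)` on the hyperelliptic curve `V² = −(q²+1)(q²+5)(q²−4)` solves
`P_VI(1/2,1/2,1/3,4/5;t)`. -/
theorem icosahedral_type47_solution
    (V : Set ℂ) (hVopen : IsOpen V)
    (Vq : ℂ → ℂ) (hVqdiff : ∀ q ∈ V, DifferentiableAt ℂ Vq q)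
    (hVq : ∀ q ∈ V, (Vq q)^2 = -((q^2+1)*(q^2+5)*(q^2-4)))
    (t47 y47 : ℂ → ℂ)
    (ht47def : ∀ q ∈ V, t47 q = 1/2 -
      (q^14+17*q^12+111*q^10+370*q^8+815*q^6+1077*q^4+169*q^2+32) * Vq q /
        (108*q^2*(q^2+1)^3*(q^2+5)^2))
    (hy47def : ∀ q ∈ V, y47 q = 1/2 -
      (q^2-1)^2*(q^4+7*q^2+16)*(q^4+7*q^2+1)*(q^8+8*q^6+28*q^4+36*q^2-10) /
        (6*q*(q^2+1)^2*(q^2+2)*(q^2+5)*(q^8+8*q^6+60*q^4+176*q^2-2))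
      - (5*q^14+85*q^12+555*q^10+1715*q^8+2590*q^6+1902*q^4+1574*q^2+322) * Vq q /
        (6*(q^2+1)^2*(q^2+2)*(q^2+5)*(q^8+8*q^6+60*q^4+176*q^2-2)))
    (hden : ∀ q ∈ V, 108*q^2*(q^2+1)^3*(q^2+5)^2 ≠ 0 ∧
      6*q*(q^2+1)^2*(q^2+2)*(q^2+5)*(q^8+8*q^6+60*q^4+176*q^2-2) ≠ 0 ∧
      6*(q^2+1)^2*(q^2+2)*(q^2+5)*(q^8+8*q^6+60*q^4+176*q^2-2) ≠ 0)
    (q₀ : ℂ) (hq₀ : q₀ ∈ V)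
    (hder : deriv t47 q₀ ≠ 0)
    (ht0 : t47 q₀ ≠ 0) (ht1 : t47 q₀ ≠ 1)
    (hy0 : y47 q₀ ≠ 0) (hy1 : y47 q₀ ≠ 1) (hyt : y47 q₀ ≠ t47 q₀)
    (Y : ℂ → ℂ) (W : Set ℂ) (hWopen : IsOpen W) (hW : t47 q₀ ∈ W)
    (hYdiff : ∀ T ∈ W, DifferentiableAt ℂ Y T ∧ DifferentiableAt ℂ (deriv Y) T)
    (V' : Set ℂ) (hV'open : IsOpen V') (hq₀V' : q₀ ∈ V') (hV'sub : V' ⊆ V)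
    (hYeq : ∀ q ∈ V', Y (t47 q) = y47 q)
    (havoid : ∀ q ∈ V', t47 q ≠ 0 ∧ t47 q ≠ 1 ∧
      Y (t47 q) ≠ 0 ∧ Y (t47 q) ≠ 1 ∧ Y (t47 q) ≠ t47 q) :
    ∃ W' : Set ℂ, IsOpen W' ∧ t47 q₀ ∈ W' ∧
      IsPVISolutionOn (1/2) (1/2) (1/3) (4/5) Y W' := by

  have hnz : ∀ q ∈ V, q ≠ 0 ∧ q^2+1 ≠ 0 ∧ q^2+2 ≠ 0 ∧ q^2+5 ≠ 0 ∧
      q^8+8*q^6+60*q^4+176*q^2-2 ≠ 0 := by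
    intro q hq
    obtain ⟨-, h, -⟩ := hden q hq
    refine ⟨?_, ?_, ?_, ?_, ?_⟩ <;> intro h0 <;> apply h <;> rw [h0] <;> ring
  have htF : ∀ q ∈ V, t47 q = tF Vq q := by
    intro q hq
    rw [ht47def q hq, tF, tC_eq]
    simp only [tB]
    ring
  have hyF : ∀ q ∈ V, y47 q = yF Vq q := by
    intro q hq
    obtain ⟨h0, h1, h2, h5, hO⟩ := hnz q hq
    rw [hy47def q hq, yF, yC_eq]
    simp only [yA, yB]
    field_simp
    ring
  have hV' : ∀ q ∈ V, 2 * Vq q * deriv Vq q = -(6*q^5+8*q^3-38*q) := by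
    intro q hq
    have hd := (hVqdiff q hq).hasDerivAt
    have e1 := hd.fun_pow 2
    have hev : (fun x => Vq x ^ 2) =ᶠ[nhds q] (fun x => -((x^2+1)*(x^2+5)*(x^2-4))) := by
      filter_upwards [hVopen.mem_nhds hq] with x hx using hVq x hx
    have e2 := (((((hasDerivAt_pow 2 q).add_const 1).fun_mul
      ((hasDerivAt_pow 2 q).add_const 5)).fun_mul ((hasDerivAt_pow 2 q).sub_const 4)).fun_neg)
    have e3 := e1.unique (e2.congr_of_eventuallyEq hev)
    norm_num at e3
    linear_combination e3
  have h4 : ∀ q ∈ V, q^2-4 ≠ 0 := by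
    intro q hq h
    obtain ⟨h0, h1, h2, h5, hO⟩ := hnz q hq
    have hv : Vq q = 0 := by
      have := hVq q hq
      rw [h] at this
      simpa using this
    have := hV' q hq
    rw [hv] at this
    have h90 : (90:ℂ) * q = 0 := by linear_combination this - (6*q^3+32*q) * h
    simp [h0] at h90
  have hVne : ∀ q ∈ V, Vq q ≠ 0 := by
    intro q hq h
    obtain ⟨h0, h1, h2, h5, hO⟩ := hnz q hq
    have := hVq q hq
    rw [h] at this
    simp [h1, h5, h4 q hq] at this
  have hX : ∀ q ∈ V', q^2-1 ≠ 0 ∧ q^4+7*q^2+16 ≠ 0 ∧ q^4+7*q^2+1 ≠ 0 := by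
    intro q hq
    obtain ⟨h0, h1, h2, h5, hO⟩ := hnz q (hV'sub hq)
    have htt := tF_tt Vq q (hVq q (hV'sub hq)) h0 h1 h5
    rw [← htF q (hV'sub hq)] at htt
    obtain ⟨a0, a1, -⟩ := havoid q hq
    have hne : t47 q * (t47 q - 1) * (11664*q^4*(q^2+1)^5*(q^2+5)^3) ≠ 0 := by
      simp [a0, sub_ne_zero.2 a1, h0, h1, h5]
    rw [htt] at hne
    refine ⟨?_, ?_, ?_⟩ <;> intro h <;> apply hne <;> rw [h] <;> ring
  have hsig : ∀ q ∈ V', sig Vq q ≠ 0 := by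
    intro q hq
    obtain ⟨h0, h1, h2, h5, hO⟩ := hnz q (hV'sub hq)
    obtain ⟨hm1, hX2, hX3⟩ := hX q hq
    simp [sig, h0, h1, hm1, hX2, hX3, h4 q (hV'sub hq), hVne q (hV'sub hq)]
  have evV : ∀ q ∈ V', ∀ᶠ x in nhds q, x ∈ V' := fun q hq => hV'open.mem_nhds hq
  have hdt : ∀ q ∈ V', HasDerivAt t47 (sig Vq q * (t47 q * (t47 q - 1))) q := by
    intro q hq
    obtain ⟨h0, h1, h2, h5, hO⟩ := hnz q (hV'sub hq)
    obtain ⟨hm1, hX2, hX3⟩ := hX q hq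
    rw [htF q (hV'sub hq)]
    refine (hd_t Vq q _ (hVqdiff q (hV'sub hq)).hasDerivAt (hVq q (hV'sub hq)) (hV' q (hV'sub hq))
      h0 h1 h5 hm1 hX2 hX3 (h4 q (hV'sub hq))).congr_of_eventuallyEq ?_
    filter_upwards [evV q hq] with x hx using htF x (hV'sub hx)
  have hdy : ∀ q ∈ V', HasDerivAt y47 (sig Vq q * (2*(y47 q*(y47 q-1))*(y47 q-t47 q)*pF Vq q
      - 1/2*(2*y47 q-1)*(y47 q-t47 q) + 2/3*(y47 q*(y47 q-1)))) q := by
    intro q hq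
    obtain ⟨h0, h1, h2, h5, hO⟩ := hnz q (hV'sub hq)
    obtain ⟨hm1, hX2, hX3⟩ := hX q hq
    rw [htF q (hV'sub hq), hyF q (hV'sub hq)]
    refine (hd_y Vq q _ (hVqdiff q (hV'sub hq)).hasDerivAt (hVq q (hV'sub hq)) (hV' q (hV'sub hq))
      h0 h1 h2 h5 hO hm1 hX2 hX3 (h4 q (hV'sub hq))).congr_of_eventuallyEq ?_
    filter_upwards [evV q hq] with x hx using hyF x (hV'sub hx)
  have hdp : ∀ q ∈ V', HasDerivAt (pF Vq) (sig Vq q *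
      (-((2*y47 q-1)*pF Vq q*((y47 q-t47 q)*pF Vq q)) - (y47 q*(y47 q-1))*pF Vq q*pF Vq q
      + (y47 q-t47 q)*pF Vq q - 1/6*((2*y47 q-1)*pF Vq q) - 4/225)) q := by
    intro q hq
    obtain ⟨h0, h1, h2, h5, hO⟩ := hnz q (hV'sub hq)
    obtain ⟨hm1, hX2, hX3⟩ := hX q hq
    rw [htF q (hV'sub hq), hyF q (hV'sub hq)]
    exact hd_p Vq q _ (hVqdiff q (hV'sub hq)).hasDerivAt (hVq q (hV'sub hq)) (hV' q (hV'sub hq))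
      h0 h1 h2 h5 hO hm1 hX2 hX3 (h4 q (hV'sub hq))
  have hdtne : ∀ q ∈ V', sig Vq q * (t47 q * (t47 q - 1)) ≠ 0 := by
    intro q hq
    obtain ⟨a0, a1, -⟩ := havoid q hq
    exact mul_ne_zero (hsig q hq) (mul_ne_zero a0 (sub_ne_zero.2 a1))
  have hopen : IsOpen (t47 '' V') := by
    rw [isOpen_iff_mem_nhds]
    rintro _ ⟨q, hq, rfl⟩
    have hdo : DifferentiableOn ℂ t47 V' := fun x hx => (hdt x hx).differentiableAt.differentiableWithinAt
    have han := (hdo.analyticAt (hV'open.mem_nhds hq)).hasStrictDerivAt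
    rw [(hdt q hq).deriv] at han
    rw [← han.map_nhds_eq (hdtne q hq)]
    exact Filter.image_mem_map (hV'open.mem_nhds hq)
  refine ⟨W ∩ t47 '' V', hWopen.inter hopen, ⟨hW, q₀, hq₀V', rfl⟩, hWopen.inter hopen, ?_, ?_, ?_⟩
  · rintro _ ⟨-, q, hq, rfl⟩
    exact havoid q hq
  · rintro T ⟨hT, -⟩
    exact hYdiff T hT
  · rintro _ ⟨hT, q, hq, rfl⟩
    obtain ⟨a0, a1, a2, a3, a4⟩ := havoid q hq
    rw [hYeq q hq] at a2 a3 a4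
    refine pvi_local t47 y47 (pF Vq) Y q _ (hsig q hq) a0 a1 a2 a3 a4 (hYeq q hq) (hdt q hq)
      (hdy q hq) (hdp q hq) (hYdiff _ hT).2 ?_
    have hcont := (hdt q hq).continuousAt
    filter_upwards [evV q hq, hcont.preimage_mem_nhds (hWopen.mem_nhds hT)] with x hx hxW
    have c1 : HasDerivAt (fun z => Y (t47 z)) _ x :=
      (hYdiff _ hxW).1.hasDerivAt.comp x (hdt x hx)
    have c2 := (hdy x hx).congr_of_eventuallyEq
      (show (fun z => Y (t47 z)) =ᶠ[nhds x] y47 by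
        filter_upwards [evV x hx] with z hz using hYeq z hz)
    have c3 := c1.unique c2
    apply mul_left_cancel₀ (hsig x hx)
    linear_combination c3
end

section
/- Let V ⊆ ℂ be open and let u : V → ℂ be a differentiable function with u(q)² = (q²+1)(q²−4q+9) for all q ∈ V (a branch on the elliptic curve u² = (q²+1)(q²−4q+9)). Define on V: t₄₄(q) = 1/2 + (q¹⁰−10q⁹+45q⁸−120q⁷+190q⁶+4q⁵−410q⁴+680q³+25q²−90q−27) / (2 (q²−4q−1)(q²+1) u(q)³), and y₄₄(q) = 1/2 + (7q¹⁰−70q⁹+329q⁸−908q⁷+1494q⁶+24q⁵−3310q⁴+5692q³+211q²−418q−171) / (2 (q²−4q−1)(7q⁶−28q⁵+91q⁴−88q³+229q²−76q+57) u(q)), assuming all denominators are nonzero on V. Let q₀ ∈ V with t₄₄'(q₀) ≠ 0, t₄₄(q₀) ∉ {0,1}, and y₄₄(q₀) ∉ {0, 1, t₄₄(q₀)}. Suppose Y is twice differentiable on a neighbourhood of t₄₄(q₀) with Y(t₄₄(q)) = y₄₄(q) for q near q₀, avoiding 0, 1 and its argument. Then Y is a solution of P_VI(1/2, 1/2, 1/5,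 1/5; t) on a neighbourhood of t₄₄(q₀) (an icosahedral algebraic Painlevé VI solution of Boalch type 44). -/
/-- Transport of a derivative along pointwise equality of functions and of values. -/
lemma ic_congr {f g : ℂ → ℂ} {a b q : ℂ} (h : HasDerivAt f a q) (hf : ∀ x, f x = g x)
    (hab : a = b) : HasDerivAt g b q := by
  have : f = g := funext hf
  subst this
  subst hab
  exact h

noncomputable def ics (q : ℂ) : ℂ :=
  q - 2

lemma ics_deriv (q : ℂ) : HasDerivAt ics
    (1) q := by
  have hs : ∀ {f : ℂ → ℂ} {a : ℂ}, HasDerivAt f a q → ∀ c : ℂ,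
      HasDerivAt (fun x => f x * x + c) (a * q + f q * 1) q :=
    fun hf c => (hf.mul (hasDerivAt_id' q)).add_const c
  refine ic_congr
    (hs (hasDerivAt_const q (1 : ℂ)) (-2)) ?_ ?_
  · intro x
    simp only [ics]
    try ring
  · ring

noncomputable def icl (q : ℂ) : ℂ :=
  2*q + 1

lemma icl_deriv (q : ℂ) : HasDerivAt icl
    (2) q := by
  have hs : ∀ {f : ℂ → ℂ} {a : ℂ}, HasDerivAt f a q → ∀ c : ℂ,
      HasDerivAt (fun x => f x * x + c) (a * q + f q * 1) q :=
    fun hf c => (hf.mul (hasDerivAt_id' q)).add_const c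
  refine ic_congr
    (hs (hasDerivAt_const q (2 : ℂ)) (1)) ?_ ?_
  · intro x
    simp only [icl]
    try ring
  · ring

noncomputable def icc (q : ℂ) : ℂ :=
  q^2 - 2*q + 5

lemma icc_deriv (q : ℂ) : HasDerivAt icc
    (2*q - 2) q := by
  have hs : ∀ {f : ℂ → ℂ} {a : ℂ}, HasDerivAt f a q → ∀ c : ℂ,
      HasDerivAt (fun x => f x * x + c) (a * q + f q * 1) q :=
    fun hf c => (hf.mul (hasDerivAt_id' q)).add_const c
  refine ic_congr
    (hs (hs (hasDerivAt_const q (1 : ℂ)) (-2)) (5)) ?_ ?_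
  · intro x
    simp only [icc]
    try ring
  · ring

noncomputable def ica1 (q : ℂ) : ℂ :=
  q^2 + 1

lemma ica1_deriv (q : ℂ) : HasDerivAt ica1
    (2*q) q := by
  have hs : ∀ {f : ℂ → ℂ} {a : ℂ}, HasDerivAt f a q → ∀ c : ℂ,
      HasDerivAt (fun x => f x * x + c) (a * q + f q * 1) q :=
    fun hf c => (hf.mul (hasDerivAt_id' q)).add_const c
  refine ic_congr
    (hs (hs (hasDerivAt_const q (1 : ℂ)) (0)) (1)) ?_ ?_
  · intro x
    simp only [ica1]
    try ring
  · ring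

noncomputable def ica2 (q : ℂ) : ℂ :=
  q^2 - 4*q + 9

lemma ica2_deriv (q : ℂ) : HasDerivAt ica2
    (2*q - 4) q := by
  have hs : ∀ {f : ℂ → ℂ} {a : ℂ}, HasDerivAt f a q → ∀ c : ℂ,
      HasDerivAt (fun x => f x * x + c) (a * q + f q * 1) q :=
    fun hf c => (hf.mul (hasDerivAt_id' q)).add_const c
  refine ic_congr
    (hs (hs (hasDerivAt_const q (1 : ℂ)) (-4)) (9)) ?_ ?_
  · intro x
    simp only [ica2]
    try ring
  · ring

noncomputable def icr (q : ℂ) : ℂ :=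
  q^2 - 4*q - 1

lemma icr_deriv (q : ℂ) : HasDerivAt icr
    (2*q - 4) q := by
  have hs : ∀ {f : ℂ → ℂ} {a : ℂ}, HasDerivAt f a q → ∀ c : ℂ,
      HasDerivAt (fun x => f x * x + c) (a * q + f q * 1) q :=
    fun hf c => (hf.mul (hasDerivAt_id' q)).add_const c
  refine ic_congr
    (hs (hs (hasDerivAt_const q (1 : ℂ)) (-4)) (-1)) ?_ ?_
  · intro x
    simp only [icr]
    try ring
  · ring

noncomputable def icQ (q : ℂ) : ℂ :=
  7*q^6 - 28*q^5 + 91*q^4 - 88*q^3 + 229*q^2 - 76*q + 57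

lemma icQ_deriv (q : ℂ) : HasDerivAt icQ
    (42*q^5 - 140*q^4 + 364*q^3 - 264*q^2 + 458*q - 76) q := by
  have hs : ∀ {f : ℂ → ℂ} {a : ℂ}, HasDerivAt f a q → ∀ c : ℂ,
      HasDerivAt (fun x => f x * x + c) (a * q + f q * 1) q :=
    fun hf c => (hf.mul (hasDerivAt_id' q)).add_const c
  refine ic_congr
    (hs (hs (hs (hs (hs (hs (hasDerivAt_const q (7 : ℂ)) (-28)) (91)) (-88)) (229)) (-76))
      (57)) ?_ ?_
  · intro x
    simp only [icQ]
    try ring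
  · ring

noncomputable def icN (q : ℂ) : ℂ :=
  21*q^10 - 210*q^9 + 1925*q^8 - 9320*q^7 + 26690*q^6 - 44284*q^5 + 35770*q^4 + 15800*q^3 -
    11335*q^2 - 8930*q + 209

noncomputable def icE (q : ℂ) : ℂ :=
  3*q^6 - 12*q^5 + 55*q^4 - 40*q^3 - 15*q^2 + 164*q - 11

noncomputable def icK (q : ℂ) : ℂ :=
  63*q^16 - 882*q^15 + 10801*q^14 - 78428*q^13 + 371469*q^12 - 1198190*q^11 + 2739853*q^10 -
    4517064*q^9 + 5398167*q^8 - 4634766*q^7 + 2918499*q^6 + 119012*q^5 - 904801*q^4 +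
    333678*q^3 - 430369*q^2 - 409792*q + 6270

lemma icK_deriv (q : ℂ) : HasDerivAt icK
    (1008*q^15 - 13230*q^14 + 151214*q^13 - 1019564*q^12 + 4457628*q^11 - 13180090*q^10 +
      27398530*q^9 - 40653576*q^8 + 43185336*q^7 - 32443362*q^6 + 17510994*q^5 + 595060*q^4 -
      3619204*q^3 + 1001034*q^2 - 860738*q - 409792) q := by
  have hs : ∀ {f : ℂ → ℂ} {a : ℂ}, HasDerivAt f a q → ∀ c : ℂ,
      HasDerivAt (fun x => f x * x + c) (a * q + f q * 1) q :=
    fun hf c => (hf.mul (hasDerivAt_id' q)).add_const c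
  refine ic_congr
    (hs (hs (hs (hs (hs (hs (hs (hs (hs (hs (hs (hs (hs (hs (hs (hs (hasDerivAt_const q (63 :
      ℂ)) (-882)) (10801)) (-78428)) (371469)) (-1198190)) (2739853)) (-4517064)) (5398167))
      (-4634766)) (2918499)) (119012)) (-904801)) (333678)) (-430369)) (-409792)) (6270)) ?_ ?_
  · intro x
    simp only [icK]
    try ring
  · ring

noncomputable def icM (q : ℂ) : ℂ :=
  882*q^28 - 17640*q^27 + 193599*q^26 - 1449819*q^25 + 8412208*q^24 - 40258421*q^23 +
    167247458*q^22 - 617736777*q^21 + 2044032172*q^20 - 5971563679*q^19 + 15096156913*q^18 -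
    32157078814*q^17 + 56232570706*q^16 - 77303298226*q^15 + 76983321532*q^14 -
    39069094834*q^13 - 29592948758*q^12 + 100810571642*q^11 - 135139506527*q^10 +
    123562490489*q^9 - 73570541708*q^8 + 31701381719*q^7 - 12547218846*q^6 + 10128903211*q^5 -
    8579951752*q^4 + 8244997085*q^3 - 1596289617*q^2 + 77196240*q - 16082550

noncomputable def icPt (q : ℂ) : ℂ :=
  q^10 - 10*q^9 + 45*q^8 - 120*q^7 + 190*q^6 + 4*q^5 - 410*q^4 + 680*q^3 + 25*q^2 - 90*q - 27

lemma icPt_deriv (q : ℂ) : HasDerivAt icPt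
    (10*q^9 - 90*q^8 + 360*q^7 - 840*q^6 + 1140*q^5 + 20*q^4 - 1640*q^3 + 2040*q^2 + 50*q - 90) q := by
  have hs : ∀ {f : ℂ → ℂ} {a : ℂ}, HasDerivAt f a q → ∀ c : ℂ,
      HasDerivAt (fun x => f x * x + c) (a * q + f q * 1) q :=
    fun hf c => (hf.mul (hasDerivAt_id' q)).add_const c
  refine ic_congr
    (hs (hs (hs (hs (hs (hs (hs (hs (hs (hs (hasDerivAt_const q (1 : ℂ)) (-10)) (45)) (-120))
      (190)) (4)) (-410)) (680)) (25)) (-90)) (-27)) ?_ ?_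
  · intro x
    simp only [icPt]
    try ring
  · ring

noncomputable def icPy (q : ℂ) : ℂ :=
  7*q^10 - 70*q^9 + 329*q^8 - 908*q^7 + 1494*q^6 + 24*q^5 - 3310*q^4 + 5692*q^3 + 211*q^2 -
    418*q - 171

lemma icPy_deriv (q : ℂ) : HasDerivAt icPy
    (70*q^9 - 630*q^8 + 2632*q^7 - 6356*q^6 + 8964*q^5 + 120*q^4 - 13240*q^3 + 17076*q^2 +
      422*q - 418) q := by
  have hs : ∀ {f : ℂ → ℂ} {a : ℂ}, HasDerivAt f a q → ∀ c : ℂ,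
      HasDerivAt (fun x => f x * x + c) (a * q + f q * 1) q :=
    fun hf c => (hf.mul (hasDerivAt_id' q)).add_const c
  refine ic_congr
    (hs (hs (hs (hs (hs (hs (hs (hs (hs (hs (hasDerivAt_const q (7 : ℂ)) (-70)) (329)) (-908))
      (1494)) (24)) (-3310)) (5692)) (211)) (-418)) (-171)) ?_ ?_
  · intro x
    simp only [icPy]
    try ring
  · ring

lemma ic_poly (q : ℂ) :
    (8192/25)*ica1 q^2*ica2 q*icr q^2*icN q*icE q*icM q +
      (8192/25)*ica1 q^4*ica2 q^2*icN q*icK q^2 +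
      (-16384/25)*q*ics q^3*icl q^2*icc q*icQ q^2*icK q^2 +
      (16384/25)*q^2*ics q^2*icl q*icc q*icE q^2*icK q^2 +
      (-8192/5)*ica1 q^6*ica2 q^3*icN q^2*icK q +
      (32768/5)*q^2*ics q^2*icl q*icc q*ica1 q^2*ica2 q*icN q*icE q^2*icK q +
      (262144/25)*q^2*ics q^2*icl q*icc q*ica1 q^4*ica2 q^2*icN q^2*icE q^2 +
      (4096)*q*ics q^3*icl q^2*icc q*ica1 q*ica2 q*icr q^2*icQ q^4*icE q^2 +
      (-4096)*q^2*ics q^2*icl q*icc q*ica1 q*ica2 q*icr q^2*icQ q^2*icE q^4 +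
      (393216/25)*q*ics q^3*icl q^2*icc q*ica1 q^4*ica2 q^2*icQ q^2*icN q^2 = 0 := by
  simp only [ics, icl, icc, ica1, ica2, icr, icQ, icN, icE, icK, icM]
  ring

/-- `2 t - 1 = u * icf`. -/
noncomputable def icf (q : ℂ) : ℂ := icPt q / (icr q * ica1 q^3 * ica2 q^2)

/-- `2 y - 1 = u * icg`. -/
noncomputable def icg (q : ℂ) : ℂ := icPy q / (icr q * icQ q * ica1 q * ica2 q)

/-- The derivative `dy/dt` as a rational function of `q`. -/
noncomputable def icp (q : ℂ) : ℂ :=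
  ica1 q^2 * ica2 q * icK q / (20 * q * ics q^3 * icl q^2 * icc q * icQ q^2)

/-- The derivative of `icp`. -/
noncomputable def icdp (q : ℂ) : ℂ :=
  ica1 q * icr q * icM q / (10 * q^2 * ics q^4 * icl q^3 * icc q^2 * icQ q^3)

/-- `2 t' = u * icT1`. -/
noncomputable def icT1 (q : ℂ) : ℂ :=
  -320 * q^2 * ics q^4 * icl q^2 * icc q / (icr q^2 * ica2 q^3 * ica1 q^4)

lemma icp_deriv (q : ℂ) (hq : q ≠ 0) (hs : ics q ≠ 0) (hl : icl q ≠ 0) (hc : icc q ≠ 0)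
    (hQ : icQ q ≠ 0) : HasDerivAt icp (icdp q) q := by
  have h1 := (((ica1_deriv q).pow 2).mul (ica2_deriv q)).mul (icK_deriv q)
  have h2 := (((((hasDerivAt_id' q).const_mul 20).mul ((ics_deriv q).pow 3)).mul
    ((icl_deriv q).pow 2)).mul (icc_deriv q)).mul ((icQ_deriv q).pow 2)
  have h3 := h1.div h2 (by simp [hq, hs, hl, hc, hQ])
  refine ic_congr h3 (fun x => rfl) ?_
  simp only [icdp, Pi.mul_apply, Pi.pow_apply]
  field_simp
  simp only [ica1, ica2, icK, ics, icl, icc, icQ, icr, icM]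
  norm_num
  ring

lemma icf_deriv (q : ℂ) (ha1 : ica1 q ≠ 0) (ha2 : ica2 q ≠ 0) (hr : icr q ≠ 0) :
    ∃ f', HasDerivAt icf f' q ∧
      (2*q*ica2 q + ica1 q * (2*q-4)) / (2 * (ica1 q * ica2 q)) * icf q + f' = icT1 q := by
  have h2 := ((icr_deriv q).mul ((ica1_deriv q).pow 3)).mul ((ica2_deriv q).pow 2)
  have h3 := (icPt_deriv q).div h2 (by simp [ha1, ha2, hr])
  refine ⟨_, ic_congr h3 (fun x => rfl) rfl, ?_⟩
  simp only [icT1, icf, Pi.mul_apply, Pi.pow_apply]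
  field_simp
  simp only [ica1, ica2, icPt, ics, icl, icc, icr]
  norm_num
  ring

lemma icg_deriv (q : ℂ) (ha1 : ica1 q ≠ 0) (ha2 : ica2 q ≠ 0) (hr : icr q ≠ 0)
    (hq : q ≠ 0) (hs : ics q ≠ 0) (hl : icl q ≠ 0) (hc : icc q ≠ 0)
    (hQ : icQ q ≠ 0) :
    ∃ g', HasDerivAt icg g' q ∧
      (2*q*ica2 q + ica1 q * (2*q-4)) / (2 * (ica1 q * ica2 q)) * icg q + g'
        = icp q * icT1 q := by
  have h2 := (((icr_deriv q).mul (icQ_deriv q)).mul (ica1_deriv q)).mul (ica2_deriv q)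
  have h3 := (icPy_deriv q).div h2 (by simp [ha1, ha2, hr, hQ])
  refine ⟨_, ic_congr h3 (fun x => rfl) rfl, ?_⟩
  simp only [icT1, icp, icg, Pi.mul_apply, Pi.pow_apply]
  field_simp
  simp only [ica1, ica2, icPy, ics, icl, icc, icr, icQ, icK]
  norm_num
  ring

lemma ic_m (q : ℂ) (ha1 : ica1 q ≠ 0) (ha2 : ica2 q ≠ 0) (hr : icr q ≠ 0) :
    ica1 q * ica2 q * icf q^2 - 1 =
      64 * q^3 * ics q^5 * icl q^3 * icc q^2 / (icr q^2 * ica2 q^3 * ica1 q^5) := by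
  simp only [icf]
  field_simp
  simp only [ica1, ica2, icPt, ics, icl, icc, icr]
  ring

lemma ic_n (q : ℂ) (ha1 : ica1 q ≠ 0) (ha2 : ica2 q ≠ 0) (hr : icr q ≠ 0) (hQ : icQ q ≠ 0) :
    ica1 q * ica2 q * icg q^2 - 1 =
      16 * q^2 * ics q^2 * icl q * icc q * icN q / (ica1 q * ica2 q * icr q^2 * icQ q^2) := by
  simp only [icg]
  field_simp
  simp only [ica1, ica2, icPy, ics, icl, icc, icr, icQ, icN]
  ring

lemma ic_d (q : ℂ) (ha1 : ica1 q ≠ 0) (ha2 : ica2 q ≠ 0) (hr : icr q ≠ 0) (hQ : icQ q ≠ 0) :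
    icg q - icf q =
      8 * q^2 * ics q^2 * icl q * icc q * icE q / (ica1 q^3 * ica2 q^2 * icr q * icQ q) := by
  simp only [icg, icf]
  field_simp
  simp only [ica1, ica2, icPt, icPy, ics, icl, icc, icr, icQ, icE]
  ring

/-- The Painlevé equation in terms of `m = T² - 1`, `n = w² - 1`, `d = w - T`. -/
lemma ic_pvi (t y p Y2 : ℂ) (m n d : ℂ) (hm : m = 4*t*(t-1)) (hn : n = 4*y*(y-1))
    (hd : d = 2*(y-t)) (ht0 : t ≠ 0) (ht1 : t ≠ 1) (hy0 : y ≠ 0) (hy1 : y ≠ 1) (hyt : y ≠ t)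
    (key : Y2 * d * (m^2*n) = p^2*(2*n-m+d^2)*m^2 - 2*p*(n-d^2)*m*n + 16/25*n^2*d^2
      + d^2*(m-d^2) + 24/25*n^2*m) :
    Y2 = (1/2) * (1/y + 1/(y - 1) + 1/(y - t)) * p^2
    - (1/t + 1/(t-1) + 1/(y - t)) * p
    + (y * (y - 1) * (y - t) / (t^2 * (t-1)^2)) *
      (((1/5:ℂ) - 1)^2/2 + (-((1/2:ℂ)^2/2)) * t/y^2 + ((1/2:ℂ)^2/2) * (t-1)/(y - 1)^2
        + ((1 - (1/5:ℂ)^2)/2) * (t*(t-1))/(y - t)^2) := by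
  have ht1' := sub_ne_zero.2 ht1
  have hy1' := sub_ne_zero.2 hy1
  have hyt' := sub_ne_zero.2 hyt
  have hD : 128 * t^2 * (t-1)^2 * y * (y-1) * (y-t) ≠ 0 := by
    simp [ht0, ht1', hy0, hy1', hyt']
  apply mul_right_cancel₀ hD
  have e : Y2 * (128 * t^2 * (t-1)^2 * y * (y-1) * (y-t)) = Y2 * d * (m^2*n) := by
    rw [hm, hn, hd]; ring
  rw [e, key, hm, hn, hd]
  field_simp
  ring

lemma ic_key (q : ℂ) (ha1 : ica1 q ≠ 0) (ha2 : ica2 q ≠ 0) (hr : icr q ≠ 0)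
    (hq : q ≠ 0) (hs : ics q ≠ 0) (hl : icl q ≠ 0) (hc : icc q ≠ 0)
    (hQ : icQ q ≠ 0) (m n d0 D : ℂ)
    (hm : m = 64 * q^3 * ics q^5 * icl q^3 * icc q^2 / (icr q^2 * ica2 q^3 * ica1 q^5))
    (hn : n = 16 * q^2 * ics q^2 * icl q * icc q * icN q /
      (ica1 q * ica2 q * icr q^2 * icQ q^2))
    (hd0 : d0 = 8 * q^2 * ics q^2 * icl q * icc q * icE q /
      (ica1 q^3 * ica2 q^2 * icr q * icQ q))
    (hD : D = ica1 q * ica2 q * d0^2) :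
    2 * icdp q / icT1 q * d0 * (m^2*n) = icp q^2*(2*n-m+D)*m^2 - 2*icp q*(n-D)*m*n
      + 16/25*n^2*D + D*(m-D) + 24/25*n^2*m := by
  rw [← sub_eq_zero]
  have h : 2 * icdp q / icT1 q * d0 * (m^2*n) - (icp q^2*(2*n-m+D)*m^2 - 2*icp q*(n-D)*m*n
      + 16/25*n^2*D + D*(m-D) + 24/25*n^2*m) =
      -(q^6 * ics q^6 * icl q^3 * icc q^3 / (ica1 q^11 * ica2 q^7 * icr q^6 * icQ q^6)) *
      (
        (8192/25)*ica1 q^2*ica2 q*icr q^2*icN q*icE q*icM q +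
          (8192/25)*ica1 q^4*ica2 q^2*icN q*icK q^2 +
          (-16384/25)*q*ics q^3*icl q^2*icc q*icQ q^2*icK q^2 +
          (16384/25)*q^2*ics q^2*icl q*icc q*icE q^2*icK q^2 +
          (-8192/5)*ica1 q^6*ica2 q^3*icN q^2*icK q +
          (32768/5)*q^2*ics q^2*icl q*icc q*ica1 q^2*ica2 q*icN q*icE q^2*icK q +
          (262144/25)*q^2*ics q^2*icl q*icc q*ica1 q^4*ica2 q^2*icN q^2*icE q^2 +
          (4096)*q*ics q^3*icl q^2*icc q*ica1 q*ica2 q*icr q^2*icQ q^4*icE q^2 +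
          (-4096)*q^2*ics q^2*icl q*icc q*ica1 q*ica2 q*icr q^2*icQ q^2*icE q^4 +
          (393216/25)*q*ics q^3*icl q^2*icc q*ica1 q^4*ica2 q^2*icQ q^2*icN q^2) := by
    rw [hD, hm, hn, hd0]
    simp only [icdp, icT1, icp]
    field_simp
    ring
  rw [h, ic_poly, mul_zero]

/-- Derivative of a branch of the square root times a rational function. -/
lemma ic_u_mul (u : ℂ → ℂ) (q : ℂ) (hud : DifferentiableAt ℂ u q)
    (hu : ∀ᶠ x in nhds q, (u x)^2 = ica1 x * ica2 x) (ha1 : ica1 q ≠ 0) (ha2 : ica2 q ≠ 0)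
    (F : ℂ → ℂ) (F' G : ℂ) (hF : HasDerivAt F F' q)
    (hG : (2*q*ica2 q + ica1 q * (2*q-4)) / (2 * (ica1 q * ica2 q)) * F q + F' = G) :
    HasDerivAt (fun x => 1/2 + u x * F x / 2) (u q * G / 2) q := by
  have h1 : HasDerivAt (fun x => (u x)^2) (2 * u q * deriv u q) q := by
    refine (hud.hasDerivAt.pow 2).congr_deriv ?_
    norm_num
  have h2 := (ica1_deriv q).mul (ica2_deriv q)
  have h3 := h1.unique (h2.congr_of_eventuallyEq hu)
  have huq := hu.self_of_nhds
  have hu0 : u q ≠ 0 := by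
    intro h
    rw [h] at huq
    exact mul_ne_zero ha1 ha2 (by rw [← huq]; norm_num)
  have h4 : deriv u q =
      u q * ((2*q*ica2 q + ica1 q * (2*q-4)) / (2 * (ica1 q * ica2 q))) := by
    rw [← huq]
    field_simp
    linear_combination h3
  refine (((hud.hasDerivAt.mul hF).div_const 2).const_add (1/2)).congr_deriv ?_
  rw [← hG, h4]
  ring

/-- The icosahedral algebraic Painlevé VI solution of Boalch type 44:
`y₄₄(t₄₄)` on the elliptic curve `u² = (q²+1)(q²−4q+9)` solves
`P_VI(1/2,1/2,1/5,1/5;t)`. -/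
theorem icosahedral_type44_solution
    (V : Set ℂ) (hVopen : IsOpen V)
    (u : ℂ → ℂ) (hudiff : ∀ q ∈ V, DifferentiableAt ℂ u q)
    (hu : ∀ q ∈ V, (u q)^2 = (q^2+1)*(q^2-4*q+9))
    (t44 y44 : ℂ → ℂ)
    (ht44def : ∀ q ∈ V, t44 q = 1/2 +
      (q^10-10*q^9+45*q^8-120*q^7+190*q^6+4*q^5-410*q^4+680*q^3+25*q^2-90*q-27) /
        (2*(q^2-4*q-1)*(q^2+1)*(u q)^3))
    (hy44def : ∀ q ∈ V, y44 q = 1/2 +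
      (7*q^10-70*q^9+329*q^8-908*q^7+1494*q^6+24*q^5-3310*q^4+5692*q^3+211*q^2-418*q-171) /
        (2*(q^2-4*q-1)*(7*q^6-28*q^5+91*q^4-88*q^3+229*q^2-76*q+57)*(u q)))
    (hden : ∀ q ∈ V, 2*(q^2-4*q-1)*(q^2+1)*(u q)^3 ≠ 0 ∧
      2*(q^2-4*q-1)*(7*q^6-28*q^5+91*q^4-88*q^3+229*q^2-76*q+57)*(u q) ≠ 0)
    (q₀ : ℂ) (hq₀ : q₀ ∈ V)
    (hder : deriv t44 q₀ ≠ 0)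
    (ht0 : t44 q₀ ≠ 0) (ht1 : t44 q₀ ≠ 1)
    (hy0 : y44 q₀ ≠ 0) (hy1 : y44 q₀ ≠ 1) (hyt : y44 q₀ ≠ t44 q₀)
    (Y : ℂ → ℂ) (W : Set ℂ) (hWopen : IsOpen W) (hW : t44 q₀ ∈ W)
    (hYdiff : ∀ T ∈ W, DifferentiableAt ℂ Y T ∧ DifferentiableAt ℂ (deriv Y) T)
    (V' : Set ℂ) (hV'open : IsOpen V') (hq₀V' : q₀ ∈ V') (hV'sub : V' ⊆ V)
    (hYeq : ∀ q ∈ V', Y (t44 q) = y44 q)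
    (havoid : ∀ q ∈ V', t44 q ≠ 0 ∧ t44 q ≠ 1 ∧
      Y (t44 q) ≠ 0 ∧ Y (t44 q) ≠ 1 ∧ Y (t44 q) ≠ t44 q) :
    ∃ W' : Set ℂ, IsOpen W' ∧ t44 q₀ ∈ W' ∧
      IsPVISolutionOn (1/2) (1/2) (1/5) (1/5) Y W' := by
  have hVn : ∀ q ∈ V, V ∈ nhds q := fun q hq => hVopen.mem_nhds hq
  have hnz : ∀ q ∈ V, ica1 q ≠ 0 ∧ ica2 q ≠ 0 ∧ icr q ≠ 0 ∧ icQ q ≠ 0 ∧ u q ≠ 0 := by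
    intro q hq
    obtain ⟨h1, h2⟩ := hden q hq
    have hu' := hu q hq
    have hu0 : u q ≠ 0 := right_ne_zero_of_mul h2
    have h3 := left_ne_zero_of_mul h2
    have hQ : icQ q ≠ 0 := right_ne_zero_of_mul h3
    have hr : icr q ≠ 0 := right_ne_zero_of_mul (left_ne_zero_of_mul h3)
    have hA : (q^2+1)*(q^2-4*q+9) ≠ 0 := by
      rw [← hu']
      exact pow_ne_zero 2 hu0
    exact ⟨left_ne_zero_of_mul hA, right_ne_zero_of_mul hA, hr, hQ, hu0⟩
  have huA : ∀ q ∈ V, (u q)^2 = ica1 q * ica2 q := hu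
  have ht : ∀ q ∈ V, t44 q = 1/2 + u q * icf q / 2 := by
    intro q hq
    obtain ⟨ha1, ha2, hr, hQ, hu0⟩ := hnz q hq
    have e : t44 q = 1/2 + icPt q / (2 * icr q * ica1 q * (u q)^3) := ht44def q hq
    have e3 : (u q)^4 = (ica1 q * ica2 q)^2 := by rw [← huA q hq]; ring
    rw [e, icf]
    field_simp
    linear_combination -(icPt q) * e3
  have hy : ∀ q ∈ V, y44 q = 1/2 + u q * icg q / 2 := by
    intro q hq
    obtain ⟨ha1, ha2, hr, hQ, hu0⟩ := hnz q hq
    have e : y44 q = 1/2 + icPy q / (2 * icr q * icQ q * u q) := hy44def q hq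
    rw [e, icg]
    field_simp
    linear_combination -(icPy q) * huA q hq
  have hm : ∀ q ∈ V, 4 * t44 q * (t44 q - 1) =
      64 * q^3 * ics q^5 * icl q^3 * icc q^2 / (icr q^2 * ica2 q^3 * ica1 q^5) := by
    intro q hq
    obtain ⟨ha1, ha2, hr, hQ, hu0⟩ := hnz q hq
    rw [← ic_m q ha1 ha2 hr, ht q hq]
    linear_combination icf q^2 * huA q hq
  have hn : ∀ q ∈ V, 4 * y44 q * (y44 q - 1) =
      16 * q^2 * ics q^2 * icl q * icc q * icN q / (ica1 q * ica2 q * icr q^2 * icQ q^2) := by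
    intro q hq
    obtain ⟨ha1, ha2, hr, hQ, hu0⟩ := hnz q hq
    rw [← ic_n q ha1 ha2 hr hQ, hy q hq]
    linear_combination icg q^2 * huA q hq
  have htd : ∀ q ∈ V, HasDerivAt t44 (u q * icT1 q / 2) q := by
    intro q hq
    obtain ⟨ha1, ha2, hr, hQ, hu0⟩ := hnz q hq
    obtain ⟨f', hf', hG⟩ := icf_deriv q ha1 ha2 hr
    refine (ic_u_mul u q (hudiff q hq) ?_ ha1 ha2 icf f' _ hf' hG).congr_of_eventuallyEq ?_
    · filter_upwards [hVn q hq] with x hx using huA x hx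
    · filter_upwards [hVn q hq] with x hx using ht x hx
  have hnz' : ∀ q ∈ V', q ≠ 0 ∧ ics q ≠ 0 ∧ icl q ≠ 0 ∧ icc q ≠ 0 := by
    intro q hq
    obtain ⟨h0, h1, -⟩ := havoid q hq
    have hne : 4 * t44 q * (t44 q - 1) ≠ 0 :=
      mul_ne_zero (mul_ne_zero (by norm_num) h0) (sub_ne_zero.2 h1)
    rw [hm q (hV'sub hq)] at hne
    refine ⟨?_, ?_, ?_, ?_⟩ <;> intro h <;> apply hne <;> simp [h]
  have hT1 : ∀ q ∈ V', icT1 q ≠ 0 := by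
    intro q hq
    obtain ⟨ha1, ha2, hr, hQ, hu0⟩ := hnz q (hV'sub hq)
    obtain ⟨h0, hs, hl, hc⟩ := hnz' q hq
    simp [icT1, ha1, ha2, hr, h0, hs, hl, hc]
  have hyd : ∀ q ∈ V', HasDerivAt y44 (u q * (icp q * icT1 q) / 2) q := by
    intro q hq'
    have hq := hV'sub hq'
    obtain ⟨ha1, ha2, hr, hQ, hu0⟩ := hnz q hq
    obtain ⟨h0, hs, hl, hc⟩ := hnz' q hq'
    obtain ⟨g', hg', hG⟩ := icg_deriv q ha1 ha2 hr h0 hs hl hc hQ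
    refine (ic_u_mul u q (hudiff q hq) ?_ ha1 ha2 icg g' _ hg' hG).congr_of_eventuallyEq ?_
    · filter_upwards [hVn q hq] with x hx using huA x hx
    · filter_upwards [hVn q hq] with x hx using hy x hx
  -- the first derivative
  have hY1 : ∀ q ∈ V', t44 q ∈ W → deriv Y (t44 q) = icp q := by
    intro q hq hqW
    obtain ⟨ha1, ha2, hr, hQ, hu0⟩ := hnz q (hV'sub hq)
    have h1 := (hYdiff _ hqW).1.hasDerivAt.comp q (htd q (hV'sub hq))
    have h2 : HasDerivAt (Y ∘ t44) (u q * (icp q * icT1 q) / 2) q := by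
      refine (hyd q hq).congr_of_eventuallyEq ?_
      filter_upwards [hV'open.mem_nhds hq] with x hx using hYeq x hx
    have h3 := h1.unique h2
    have h4 : u q * icT1 q / 2 ≠ 0 := by simp [hu0, hT1 q hq]
    apply mul_right_cancel₀ h4
    rw [h3]
    ring
  have hgood : ∀ q ∈ V', t44 q ∈ W → ∀ᶠ x in nhds q, x ∈ V' ∧ t44 x ∈ W := by
    intro q hq hqW
    exact Filter.Eventually.and (hV'open.mem_nhds hq)
      ((htd q (hV'sub hq)).continuousAt.eventually (hWopen.mem_nhds hqW))
  -- the second derivative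
  have hY2 : ∀ q ∈ V', t44 q ∈ W →
      deriv (deriv Y) (t44 q) * u q = 2 * icdp q / icT1 q := by
    intro q hq hqW
    obtain ⟨ha1, ha2, hr, hQ, hu0⟩ := hnz q (hV'sub hq)
    obtain ⟨h0, hs, hl, hc⟩ := hnz' q hq
    have h1 := (hYdiff _ hqW).2.hasDerivAt.comp q (htd q (hV'sub hq))
    have h2 : HasDerivAt (deriv Y ∘ t44) (icdp q) q := by
      refine (icp_deriv q h0 hs hl hc hQ).congr_of_eventuallyEq ?_
      filter_upwards [hgood q hq hqW] with x hx using hY1 x hx.1 hx.2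
    have h3 := h1.unique h2
    rw [eq_div_iff (hT1 q hq)]
    linear_combination 2 * h3
  have hP : ∀ q ∈ V', t44 q ∈ W → PVIAt (1/2) (1/2) (1/5) (1/5) Y (t44 q) := by
    intro q hq hqW
    have hqV := hV'sub hq
    obtain ⟨ha1, ha2, hr, hQ, hu0⟩ := hnz q hqV
    obtain ⟨h0, hs, hl, hc⟩ := hnz' q hq
    obtain ⟨k1, k2, k3, k4, k5⟩ := havoid q hq
    have key := ic_key q ha1 ha2 hr h0 hs hl hc hQ _ _ _ _ rfl rfl rfl rfl
    rw [← hm q hqV, ← hn q hqV, ← ic_d q ha1 ha2 hr hQ, ← huA q hqV, ← hY2 q hq hqW,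
      ← hY1 q hq hqW, ← hYeq q hq, ← mul_pow] at key
    have hd : u q * (icg q - icf q) = 2 * (Y (t44 q) - t44 q) := by
      rw [hYeq q hq, hy q hqV, ht q hqV]
      ring
    unfold PVIAt pviRHS
    refine ic_pvi (t44 q) (Y (t44 q)) (deriv Y (t44 q)) _ _ _ _ rfl rfl hd k1 k2 k3 k4 k5 ?_
    rw [← key]
    ring
  -- the neighbourhood
  have hq₀V : q₀ ∈ V := hV'sub hq₀V'
  have han : AnalyticAt ℂ t44 q₀ := by
    refine DifferentiableOn.analyticAt (s := V) ?_ (hVn q₀ hq₀V)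
    exact fun q hq => (htd q hq).differentiableAt.differentiableWithinAt
  have hmap := han.hasStrictDerivAt.map_nhds_eq hder
  have himg : t44 '' {x | x ∈ V' ∧ t44 x ∈ W} ∈ nhds (t44 q₀) := by
    rw [← hmap]
    exact Filter.image_mem_map (hgood q₀ hq₀V' hW)
  refine ⟨interior (t44 '' {x | x ∈ V' ∧ t44 x ∈ W}), isOpen_interior,
    mem_interior_iff_mem_nhds.2 himg, isOpen_interior, ?_, ?_, ?_⟩
  · intro T hT
    obtain ⟨q, ⟨hq, hqW⟩, rfl⟩ := interior_subset hT
    exact havoid q hq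
  · intro T hT
    obtain ⟨q, ⟨hq, hqW⟩, rfl⟩ := interior_subset hT
    exact hYdiff _ hqW
  · intro T hT
    obtain ⟨q, ⟨hq, hqW⟩, rfl⟩ := interior_subset hT
    exact hP q hq hqW
end
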